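/- arXiv:1005.4959 — 3 statements merged into one kernel-verified Lean document; each statement's English description precedes it below -/
import Mathlib

section
/- A(21,10) ≤ 47. That is, every binary code of length 21 in which any two distinct codewords have Hamming distance at least 10 has at most 47 codewords. -/
/-- Coefficient vectors of the rank-one terms with constant kernel, for two words at distance `t`;
the key `100 * i + j` stands for a word at distances `i` and `j` from them. -/
def tableConst (t : ℕ) : List (ℕ × List ℤ) :=
  match t with
  | 10 => [
      (10, [-3325398, -7106223, 3841103, -218328, -7705085]),
      (1000, [-3325398, -7106223, -3841103, 218328, 7705085]), (1010, [-85509, 343574, 0, 0, 0]),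
      (1012, [-65791, 192329, -64288, -174144, -26980]),
      (1014, [257794, 314027, -371621, -16732, 57591]),
      (1016, [1421456, 78449, -1572690, -56013, 120782]),
      (1018, [3007768, 93558, -3145456, -3424, -123937]),
      (1020, [4260576, 2302830, -4160775, 2139796, -1655177]),
      (1210, [-65791, 192329, 64288, 174144, 26980]), (1212, [-49926, 226111, 0, 0, 0]),
      (1214, [54246, 364664, -239830, 48840, 63535]),
      (1216, [817303, 466921, -1006138, 161628, -194995]),
      (1218, [1589464, 950921, -2344466, -59246, -1173497]),
      (1220, [3888733, 905733, -4201815, 173814, -945827]),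
      (1410, [257794, 314027, 371621, 16732, -57591]),
      (1412, [54246, 364664, 239830, -48840, -63535]), (1414, [631244, 269711, 0, 0, 0]),
      (1416, [1745518, 2360, -1210264, -38329, 83618]),
      (1418, [2689037, -996915, -2542358, -66293, -987741]),
      (1610, [1421456, 78449, 1572690, 56013, -120782]),
      (1612, [817303, 466921, 1006138, -161628, 194995]),
      (1614, [1745518, 2360, 1210264, 38329, -83618]), (1616, [2952199, -185963, 0, 0, 0]),
      (1810, [3007768, 93558, 3145456, 3424, 123937]),
      (1812, [1589464, 950921, 2344466, 59246, 1173497]),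
      (1814, [2689037, -996915, 2542358, 66293, 987741]),
      (2010, [4260576, 2302830, 4160775, -2139796, 1655177]),
      (2012, [3888733, 905733, 4201815, -173814, 945827])]
  | 12 => [
      (12, [-4523988, -639018, -1437807, -2573277, -2884572, 34174]),
      (1010, [43590, 105062, 0, 0, 0, -11834]),
      (1012, [63394, 72848, -129719, 79766, 8996, 663]),
      (1014, [175243, 170075, -222292, 9162, 45086, 6780]),
      (1016, [865848, 42363, -549122, -217248, -50366, 72046]),
      (1018, [2771382, -481029, -994561, -1416798, 87850, 456649]),
      (1020, [2474035, -1803917, -2162858, -1271905, -556873, 42568]),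
      (1200, [-4523988, -639018, 1437807, 2573277, 2884572, 34174]),
      (1210, [63394, 72848, 129719, -79766, -8996, 663]),
      (1212, [114239, -64767, 0, 0, 0, -8180]),
      (1214, [271162, 118101, -74656, -45103, 63607, -30624]),
      (1216, [850281, 99954, -428115, -149161, -85727, 22890]),
      (1218, [2372994, -193889, -1617214, -999154, -390329, -209787]),
      (1410, [175243, 170075, 222292, -9162, -45086, 6780]),
      (1412, [271162, 118101, 74656, 45103, -63607, -30624]),
      (1414, [413383, 54342, 0, 0, 0, 11093]),
      (1416, [765367, -718890, 150651, -501364, 107226, -40789]),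
      (1610, [865848, 42363, 549122, 217248, 50366, 72046]),
      (1612, [850281, 99954, 428115, 149161, 85727, 22890]),
      (1614, [765367, -718890, -150651, 501364, -107226, -40789]),
      (1810, [2771382, -481029, 994561, 1416798, -87850, 456649]),
      (1812, [2372994, -193889, 1617214, 999154, 390329, -209787]),
      (2010, [2474035, -1803917, 2162858, 1271905, 556873, 42568])]
  | 14 => [
      (14, [-8003394, 6387670, -3778476, 5747512]), (1010, [-20241, 0, 144484, 0]),
      (1012, [58206, -24714, 85609, -5457]), (1014, [275441, -350664, 365512, -33369]),
      (1016, [3048239, -3173942, -33342, -29987]), (1018, [5932968, -6165237, -996661, 847683]),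
      (1210, [58206, 24714, 85609, 5457]), (1212, [151939, 0, 129873, 0]),
      (1214, [520378, -68091, 192307, -76136]), (1216, [1472068, -874619, -269630, 255032]),
      (1400, [-8003394, -6387670, -3778476, -5747512]), (1410, [275441, 350664, 365512, 33369]),
      (1412, [520378, 68091, 192307, 76136]), (1414, [1578907, 0, -143805, 0]),
      (1610, [3048239, 3173942, -33342, 29987]), (1612, [1472068, 874619, -269630, -255032]),
      (1810, [5932968, 6165237, -996661, -847683])]
  | 16 => [
      (16, [-12362203, 12243057, -18928648, -7293749]), (1010, [-170449, 0, 962723, 0]),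
      (1012, [13689, -92787, 422065, -24805]), (1014, [1011369, -1173565, 598525, -862636]),
      (1016, [7346778, -5888909, -68264, 280451]), (1210, [13689, 92787, 422065, 24805]),
      (1212, [215088, 0, 317241, 0]), (1214, [1135306, 68126, 71349, 93685]),
      (1410, [1011369, 1173565, 598525, 862636]), (1412, [1135306, -68126, 71349, -93685]),
      (1600, [-12362203, -12243057, -18928648, 7293749]),
      (1610, [7346778, 5888909, -68264, -280451])]
  | 18 => [
      (18, [-24573646, -6040603, 14334577, -4209000]), (1010, [1155702, -407678, 0, 0]),
      (1012, [295097, 3981, -222445, 3265]), (1014, [913983, 2127977, -1386497, -24122]),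
      (1210, [295097, 3981, 222445, -3265]), (1212, [190665, 12446, 0, 0]),
      (1410, [913983, 2127977, 1386497, 24122]),
      (1800, [-24573646, -6040603, -14334577, 4209000])]
  | _ => []

/-- Coefficient vectors for the coordinates in which two words at distance `t` differ. -/
def tableDiff (t : ℕ) : List (ℕ × List ℤ) :=
  match t with
  | 10 => [
      (1010, [28484, -1160, 0]), (1012, [23461, 5117, -3577]), (1014, [31069, -1216, -13]),
      (1016, [31139, -1125, -23]), (1018, [30373, -284, -124]), (1210, [23461, 5117, 3577]),
      (1212, [12843, 142, 0]), (1214, [19974, 3783, -110]), (1216, [49600, 3237, 2122]),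
      (1218, [88777, 1314, 2782]), (1220, [-11803, 43741, -7756]), (1410, [31069, -1216, 13]),
      (1412, [19974, 3783, 110]), (1414, [33964, -1226, 0]), (1416, [34424, -1254, -13]),
      (1418, [18286, -48, -192]), (1610, [31139, -1125, 23]), (1612, [49600, 3237, -2122]),
      (1614, [34424, -1254, 13]), (1616, [33276, -1100, 0]), (1810, [30373, -284, 124]),
      (1812, [88777, 1314, -2782]), (1814, [18286, -48, 192]), (2012, [-11803, 43741, 7756])]
  | 12 => [
      (1010, [19788, -13307]), (1012, [15902, 1561]), (1014, [20038, 6809]),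
      (1016, [32348, 3537]), (1018, [71917, 18427]), (1020, [-18368, 54925]),
      (1210, [15902, 1561]), (1212, [8559, 5830]), (1214, [15821, 10151]),
      (1216, [38630, 19702]), (1218, [74108, 52730]), (1410, [20038, 6809]),
      (1412, [15821, 10151]), (1414, [15630, 5020]), (1416, [28679, 27062]),
      (1610, [32348, 3537]), (1612, [38630, 19702]), (1614, [28679, 27062]),
      (1810, [71917, 18427]), (1812, [74108, 52730]), (2010, [-18368, 54925])]
  | 14 => [
      (1010, [21668, 6702]), (1012, [7999, 1898]), (1014, [23655, 6591]), (1016, [25412, 7112]),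
      (1018, [15250, 3011]), (1210, [7999, 1898]), (1212, [7553, 1000]), (1214, [27181, 6323]),
      (1216, [31233, 4747]), (1410, [23655, 6591]), (1412, [27181, 6323]),
      (1414, [55537, -8696]), (1610, [25412, 7112]), (1612, [31233, 4747]),
      (1810, [15250, 3011])]
  | 16 => [
      (1010, [-1528, -12592]), (1012, [10566, -75]), (1014, [213623, -6754]),
      (1016, [468960, 1714]), (1210, [10566, -75]), (1212, [7245, 114]), (1214, [63924, 14896]),
      (1410, [213623, -6754]), (1412, [63924, 14896]), (1610, [468960, 1714])]
  | 18 => [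
      (1010, [-3761]), (1012, [13898]), (1014, [237847]), (1210, [13898]), (1212, [8529]),
      (1410, [237847])]
  | _ => []

/-- Coefficient vectors for the coordinates in which two words at distance `t` agree. -/
def tableAgree (t : ℕ) : List (ℕ × List ℤ) :=
  match t with
  | 10 => [
      (1010, [27146, -1378, 66, 0]), (1012, [22426, 3772, -869, -1605]),
      (1014, [29602, -1488, 69, -8]), (1016, [29669, -1480, 68, -18]),
      (1018, [29130, -1308, 46, -137]), (1020, [-85477, 11407, -1097, -9763]),
      (1210, [22426, 3772, -869, 1605]), (1212, [14879, 803, 140, 0]),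
      (1214, [23070, 6470, 4186, 1736]), (1216, [48387, 9719, -1522, 1892]),
      (1218, [83309, 9561, -2107, 1503]), (1410, [29602, -1488, 69, 8]),
      (1412, [23070, 6470, 4186, -1736]), (1414, [32340, -1614, 74, 0]),
      (1416, [32906, -1623, 72, -5]), (1610, [29669, -1480, 68, 18]),
      (1612, [48387, 9719, -1522, -1892]), (1614, [32906, -1623, 72, 5]),
      (1810, [29130, -1308, 46, 137]), (1812, [83309, 9561, -2107, -1503]),
      (2010, [-85477, 11407, -1097, 9763])]
  | 12 => [
      (1010, [26131, -8282]), (1012, [15177, 4496]), (1014, [15119, 11162]),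
      (1016, [33370, 13676]), (1018, [61517, 11074]), (1210, [15177, 4496]),
      (1212, [7834, 7672]), (1214, [16500, 9942]), (1216, [37786, 37016]),
      (1410, [15119, 11162]), (1412, [16500, 9942]), (1414, [19736, 9533]),
      (1610, [33370, 13676]), (1612, [37786, 37016]), (1810, [61517, 11074])]
  | 14 => [
      (1010, [32091, -273]), (1012, [10689, -1]), (1014, [34738, 478]), (1016, [36987, 1130]),
      (1210, [10689, -1]), (1212, [6887, -6]), (1214, [29769, 256]), (1410, [34738, 478]),
      (1412, [29769, 256]), (1610, [36987, 1130])]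
  | 16 => [
      (1010, [-2044, 22613]), (1012, [15117, -283]), (1014, [382345, 806]),
      (1210, [15117, -283]), (1212, [6487, -1606]), (1410, [382345, 806])]
  | _ => []

/-- Coefficient of a word at distance `d` in the single-centre term. -/
def centreCoef (d : ℕ) : ℤ :=
  match d with
  | 10 => 31445
  | 12 => 13804
  | 14 => 33629
  | 16 => 31284
  | 18 => 6964
  | _ => 0

/-- Multiplier of a triple of words with pairwise distances `x`, `y`, `z`. -/
def tripleCoef (x y z : ℕ) : ℤ :=
  match x * y * z with
  | 0 =>
    match x + y + z with
    | 0 => 96476182912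
    | 20 => 2920095517035
    | 24 => 815841974269
    | 28 => 3273683025638
    | 32 => 15361438943609
    | 36 => 18573269942343
    | 40 => 1078887902
    | _ => 0
  | 1000 => -154939562288
  | 1600 => -30858666084
  | 2240 => -179431124042
  | 2744 => -36417328721
  | _ => 0

/-- The entry of an association list at a key, empty if there is none. -/
def assoc : List (ℕ × List ℤ) → ℕ → List ℤ
  | [], _ => []
  | p :: l, k => bif Nat.beq p.1 k then p.2 else assoc l k

/-- The dot product of two integer lists, truncated to the shorter one. -/
def listDot : List ℤ → List ℤ → ℤ
  | x :: l, y :: m => x * y + listDot l m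
  | _, _ => 0

/-- The `±1` inner product of two words of length 21 at distance `d`. -/
def ipOf (d : ℕ) : ℤ := 21 - 2 * d

/-- Kernel of the single-centre term. -/
def centreKernel (i j : ℕ) (s : ℤ) : ℤ :=
  380 * (s * s - 21) - 40 * ipOf i * (s * ipOf j - ipOf i) +
    (19 + ipOf i * ipOf i) * (ipOf j * ipOf j - 21)

/-- A product of two table entries, for `c` and `d` relative to two words at distance `t`. -/
def tableDot (T : ℕ → List (ℕ × List ℤ)) (t ac ad bc bd : ℕ) : ℤ :=
  listDot (assoc (T t) (100 * ac + bc)) (assoc (T t) (100 * ad + bd))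

/-- The part of the quadruple function not involving the fourfold correlation. -/
def quadConst (ab ac ad bc bd cd : ℕ) : ℤ :=
  bif Nat.beq ab 0 then centreCoef ac * centreCoef ad * centreKernel ac ad (ipOf cd)
  else
    tableDot tableConst ab ac ad bc bd +
      (2 * ab * ipOf cd - (ipOf ac - ipOf bc) * (ipOf ad - ipOf bd)) *
        tableDot tableDiff ab ac ad bc bd +
      (2 * (21 - ab) * ipOf cd - (ipOf ac + ipOf bc) * (ipOf ad + ipOf bd)) *
        tableDot tableAgree ab ac ad bc bd

/-- The coefficient of the fourfold correlation in the quadruple function. -/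
def quadSlope (ab ac ad bc bd : ℕ) : ℤ :=
  bif Nat.beq ab 0 then 0
  else 2 * (21 - ab) * tableDot tableAgree ab ac ad bc bd -
    2 * ab * tableDot tableDiff ab ac ad bc bd

/-- One if the two words coincide. -/
def eqInd (d : ℕ) : ℤ := bif Nat.beq d 0 then 1 else 0

/-- The multiplier term of a triple and a further word at distances `p`, `q`, `r`. -/
def tripleTerm (x y z p q r : ℕ) : ℤ :=
  tripleCoef x y z * (3 - 48 * (eqInd p + eqInd q + eqInd r))

/-- The part of the symmetrized total not involving the fourfold correlation. -/
def totalConst (ab ac ad bc bd cd : ℕ) : ℤ :=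
  2 * (quadConst ab ac ad bc bd cd + quadConst ac ab ad bc cd bd + quadConst ad ab ac bd cd bc +
    quadConst bc ab bd ac cd ad + quadConst bd ab bc ad cd ac + quadConst cd ac bc ad bd ab) +
  (tripleTerm ab ac bc ad bd cd + tripleTerm ab ad bd ac bc cd + tripleTerm ac ad cd ab bc bd +
    tripleTerm bc bd cd ab ac ad)

/-- The coefficient of the fourfold correlation in the symmetrized total. -/
def totalSlope (ab ac ad bc bd cd : ℕ) : ℤ :=
  2 * (quadSlope ab ac ad bc bd + quadSlope ac ab ad bc cd + quadSlope ad ab ac bd cd +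
    quadSlope bc ab bd ac cd + quadSlope bd ab bc ad cd + quadSlope cd ac bc ad bd)

/-- The distances that occur in an even code of minimum distance 10. -/
def dists : List ℕ := [0, 10, 12, 14, 16, 18, 20]

/-- Triangle inequalities for three words of length 21. -/
def isTri (x y z : ℕ) : Bool :=
  Nat.ble x (y + z) && Nat.ble y (x + z) && Nat.ble z (x + y) && Nat.ble (x + y + z) 42

/-- Twenty-one minus half the perimeter: the number of coordinates where three words agree. -/
def agree (x y z : ℕ) : ℕ := 21 - (x + y + z) / 2

/-- Negativity of the total for six distances, at both ends `lo`, `hi` of the range of the number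
of coordinates where four words agree; `s` is the sum of the same numbers for the four triples. -/
def checkQuad (ab ac ad bc bd cd lo hi s : ℕ) : Bool :=
  !(Nat.ble lo hi) ||
   (decide (totalConst ab ac ad bc bd cd +
      totalSlope ab ac ad bc bd cd * (21 - 2 * s + 8 * lo) < 0) &&
   decide (totalConst ab ac ad bc bd cd +
      totalSlope ab ac ad bc bd cd * (21 - 2 * s + 8 * hi) < 0))

/-- Negativity of the total for all distances of four words. -/
def checkAll : Bool :=
  dists.all fun ab => dists.all fun ac => dists.all fun bc => !(isTri ab ac bc) ||
    dists.all fun ad => dists.all fun bd => !(isTri ab ad bd) ||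
      dists.all fun cd => !(isTri ac ad cd) || !(isTri bc bd cd) ||
        checkQuad ab ac ad bc bd cd
          (max (max (agree ab ac bc + agree ab ad bd + ab - 21)
            (agree ab ac bc + agree ac ad cd + ac - 21)) (agree ab ad bd + agree ac ad cd + ad - 21))
          (min (min (agree ab ac bc) (agree ab ad bd)) (min (agree ac ad cd) (agree bc bd cd)))
          (agree ab ac bc + agree ab ad bd + agree ac ad cd + agree bc bd cd)

theorem checkAll_eq_true : checkAll = true := by decide +kernel

/-- The word `u` as a `±1` vector. -/
def sgn (u : Fin 21 → Bool) (i : Fin 21) : ℤ := bif u i then 1 else -1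

theorem sgn_mul_self (u : Fin 21 → Bool) (i : Fin 21) : sgn u i * sgn u i = 1 := by
  unfold sgn; cases u i <;> rfl

theorem hammingDist_eq_sum (u v : Fin 21 → Bool) :
    hammingDist u v = ∑ i, if u i ≠ v i then 1 else 0 := by
  rw [hammingDist, Finset.card_filter]

theorem sum_sgn_mul_sgn (u v : Fin 21 → Bool) :
    ∑ i, sgn u i * sgn v i = ipOf (hammingDist u v) := by
  have h : (21 : ℤ) = ∑ _i : Fin 21, 1 := by simp
  rw [ipOf, hammingDist_eq_sum, h]
  push_cast
  rw [Finset.mul_sum, ← Finset.sum_sub_distrib]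
  refine Finset.sum_congr rfl fun i _ => ?_
  unfold sgn
  cases u i <;> cases v i <;> simp

/-- The fourfold correlation of four words. -/
def corr (a b c d : Fin 21 → Bool) : ℤ := ∑ i, sgn a i * sgn b i * sgn c i * sgn d i

theorem corr_swap_left (a b c d : Fin 21 → Bool) : corr b a c d = corr a b c d :=
  Finset.sum_congr rfl fun _ _ => by ring

theorem corr_swap_mid (a b c d : Fin 21 → Bool) : corr a c b d = corr a b c d :=
  Finset.sum_congr rfl fun _ _ => by ring

theorem corr_swap_right (a b c d : Fin 21 → Bool) : corr a b d c = corr a b c d :=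
  Finset.sum_congr rfl fun _ _ => by ring

section PosSemidef

variable {α ι : Type*} [Fintype ι]

/-- The integer kernel `M` is positive semidefinite on `C`. -/
def IsPSD (C : Finset α) (M : α → α → ℤ) : Prop :=
  ∀ g : α → ℤ, 0 ≤ ∑ c ∈ C, ∑ d ∈ C, g c * g d * M c d

theorem sum_mul_gram (C : Finset α) (g : α → ℤ) (h : α → ι → ℤ) :
    ∑ c ∈ C, ∑ d ∈ C, g c * g d * ∑ k, h c k * h d k = ∑ k, (∑ c ∈ C, g c * h c k) ^ 2 := by
  simp_rw [sq, Finset.sum_mul_sum]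
  refine Eq.symm (Finset.sum_comm.trans (Finset.sum_congr rfl fun c _ =>
    Finset.sum_comm.trans (Finset.sum_congr rfl fun d _ => ?_)))
  rw [Finset.mul_sum]
  exact Finset.sum_congr rfl fun k _ => by ring

theorem isPSD_gram (C : Finset α) (h : α → ι → ℤ) :
    IsPSD C fun c d => ∑ k, h c k * h d k := fun g => by
  rw [sum_mul_gram]
  positivity

/-- Variance form: `n` times the second moment minus the squared first moment. -/
theorem isPSD_variance (C : Finset α) (h : α → ι → ℤ) (S : Finset ι)
    (hS : ∀ c, ∀ k ∉ S, h c k = 0) :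
    IsPSD C fun c d => (S.card : ℤ) * ∑ k, h c k * h d k - (∑ k, h c k) * ∑ k, h d k := by
  intro g
  set y : ι → ℤ := fun k => ∑ c ∈ C, g c * h c k with hy
  have hy0 : ∀ k ∉ S, y k = 0 := fun k hk =>
    Finset.sum_eq_zero fun c _ => by rw [hS c k hk, mul_zero]
  have h1 : ∑ c ∈ C, g c * ∑ k, h c k = ∑ k, y k := by
    simp_rw [hy, Finset.mul_sum]
    exact Finset.sum_comm
  have h2 : ∑ c ∈ C, ∑ d ∈ C, g c * g d *
      ((S.card : ℤ) * ∑ k, h c k * h d k - (∑ k, h c k) * ∑ k, h d k) =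
      S.card * ∑ k, y k ^ 2 - (∑ k, y k) ^ 2 := by
    rw [← sum_mul_gram, ← h1, sq, Finset.sum_mul_sum, Finset.mul_sum, ← Finset.sum_sub_distrib]
    refine Finset.sum_congr rfl fun c _ => ?_
    rw [Finset.mul_sum, ← Finset.sum_sub_distrib]
    exact Finset.sum_congr rfl fun d _ => by ring
  rw [h2, ← Finset.sum_subset S.subset_univ fun k _ hk => hy0 k hk,
    ← Finset.sum_subset (f := fun k => y k ^ 2) S.subset_univ fun k _ hk => by simp [hy0 k hk]]
  exact sub_nonneg.2 sq_sum_le_card_mul_sum_sq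

theorem listDot_eq (l m : List ℤ) :
    listDot l m = l.headD 0 * m.headD 0 + listDot l.tail m.tail := by
  cases l <;> cases m <;> simp [listDot]

theorem IsPSD.listDot {C : Finset α} {M : α → α → ℤ} (hM : IsPSD C M) (v : α → List ℤ) :
    0 ≤ ∑ c ∈ C, ∑ d ∈ C, M c d * listDot (v c) (v d) := by
  obtain ⟨n, hn⟩ : ∃ n, ∀ c ∈ C, (v c).length ≤ n :=
    ⟨_, fun c hc => Finset.le_sup (f := fun c => (v c).length) hc⟩
  induction n generalizing v with
  | zero =>
    refine (Finset.sum_eq_zero fun c hc => Finset.sum_eq_zero fun d _ => ?_).ge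
    rw [List.length_eq_zero_iff.1 (Nat.le_zero.1 (hn c hc))]
    simp [_root_.listDot]
  | succ n ih =>
    have h := add_nonneg (hM fun c => (v c).headD 0)
      (ih (fun c => (v c).tail) fun c hc => by
        have := hn c hc
        simp only [List.length_tail]
        omega)
    rw [← Finset.sum_add_distrib] at h
    refine h.trans_eq (Finset.sum_congr rfl fun c _ => ?_)
    rw [← Finset.sum_add_distrib]
    refine Finset.sum_congr rfl fun d _ => ?_
    rw [listDot_eq (v c) (v d)]
    ring

end PosSemidef

theorem sum_affine_mul_affine {u v : Fin 21 → ℤ} (p q r t : ℤ) :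
    ∑ x, (p * u x + q) * (r * v x + t) =
      p * r * ∑ x, u x * v x + p * t * ∑ x, u x + q * r * ∑ x, v x + 21 * (q * t) := by
  have h : (21 : ℤ) * (q * t) = ∑ _x : Fin 21, q * t := by simp
  rw [h, Finset.mul_sum, Finset.mul_sum, Finset.mul_sum, ← Finset.sum_add_distrib,
    ← Finset.sum_add_distrib, ← Finset.sum_add_distrib]
  exact Finset.sum_congr rfl fun x _ => by ring

/-- The off-diagonal quadratic feature with zero row sums of a `±1` vector `u` of sum `A`. -/
def offDiag (u : Fin 21 → ℤ) (A : ℤ) (k : Fin 21 × Fin 21) : ℤ :=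
  if k.1 = k.2 then 0 else 380 * (u k.1 * u k.2) - 20 * A * (u k.1 + u k.2) + (19 + A * A)

theorem sum_offDiag_mul (u v : Fin 21 → ℤ) (hu : ∀ x, u x * u x = 1) (hv : ∀ x, v x * v x = 1)
    {A B s : ℤ} (hA : ∑ x, u x = A) (hB : ∑ x, v x = B) (hs : ∑ x, u x * v x = s) :
    ∑ k, offDiag u A k * offDiag v B k =
      380 * (380 * (s * s - 21) - 40 * A * (s * B - A) + (19 + A * A) * (B * B - 21)) := by
  have h1 : ∀ x, ∑ y, offDiag u A (x, y) * offDiag v B (x, y) =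
      (∑ y, ((380 * u x - 20 * A) * u y + (-20 * A * u x + (19 + A * A))) *
        ((380 * v x - 20 * B) * v y + (-20 * B * v x + (19 + B * B)))) -
      (-40 * A * u x + (399 + A * A)) * (-40 * B * v x + (399 + B * B)) := fun x => by
    rw [eq_sub_iff_add_eq]
    have : (-40 * A * u x + (399 + A * A)) * (-40 * B * v x + (399 + B * B)) =
        ∑ y, if x = y then
          (-40 * A * u x + (399 + A * A)) * (-40 * B * v x + (399 + B * B)) else 0 := by simp
    rw [this, ← Finset.sum_add_distrib]
    refine Finset.sum_congr rfl fun y _ => ?_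
    by_cases h : x = y
    · subst h
      have e1 : (380 * u x - 20 * A) * u x + (-20 * A * u x + (19 + A * A)) =
          -40 * A * u x + (399 + A * A) := by linear_combination 380 * hu x
      have e2 : (380 * v x - 20 * B) * v x + (-20 * B * v x + (19 + B * B)) =
          -40 * B * v x + (399 + B * B) := by linear_combination 380 * hv x
      rw [e1, e2]
      simp [offDiag]
    · simp only [offDiag, h, if_false]
      ring
  rw [Fintype.sum_prod_type]
  simp_rw [h1, sum_affine_mul_affine, hA, hB, hs]
  have e : ∀ x, (380 * u x - 20 * A) * (380 * v x - 20 * B) * s +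
        (380 * u x - 20 * A) * (-20 * B * v x + (19 + B * B)) * A +
        (-20 * A * u x + (19 + A * A)) * (380 * v x - 20 * B) * B +
        21 * ((-20 * A * u x + (19 + A * A)) * (-20 * B * v x + (19 + B * B))) -
      (-40 * A * u x + (399 + A * A)) * (-40 * B * v x + (399 + B * B)) =
      s * ((380 * u x + -20 * A) * (380 * v x + -20 * B)) +
        A * ((380 * u x + -20 * A) * (-20 * B * v x + (19 + B * B))) +
        B * ((-20 * A * u x + (19 + A * A)) * (380 * v x + -20 * B)) +
        21 * ((-20 * A * u x + (19 + A * A)) * (-20 * B * v x + (19 + B * B))) +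
      -1 * ((-40 * A * u x + (399 + A * A)) * (-40 * B * v x + (399 + B * B))) := fun x => by
    ring
  simp_rw [e, Finset.sum_add_distrib, ← Finset.mul_sum, sum_affine_mul_affine, hA, hB, hs]
  ring

theorem isPSD_centreKernel (C : Finset (Fin 21 → Bool)) (a : Fin 21 → Bool) :
    IsPSD C fun c d =>
      centreKernel (hammingDist a c) (hammingDist a d) (ipOf (hammingDist c d)) := by
  intro g
  have h := isPSD_gram C
    (fun c => offDiag (fun x => sgn a x * sgn c x) (ipOf (hammingDist a c))) g
  have e : ∀ c d : Fin 21 → Bool, ∑ k, offDiag (fun x => sgn a x * sgn c x)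
      (ipOf (hammingDist a c)) k * offDiag (fun x => sgn a x * sgn d x)
      (ipOf (hammingDist a d)) k = 380 *
      centreKernel (hammingDist a c) (hammingDist a d) (ipOf (hammingDist c d)) := fun c d => by
    refine sum_offDiag_mul _ _ (fun x => ?_) (fun x => ?_) (sum_sgn_mul_sgn a c)
      (sum_sgn_mul_sgn a d) ?_
    · linear_combination sgn c x * sgn c x * sgn_mul_self a x + sgn_mul_self c x
    · linear_combination sgn d x * sgn d x * sgn_mul_self a x + sgn_mul_self d x
    · rw [← sum_sgn_mul_sgn c d]
      exact Finset.sum_congr rfl fun x _ => by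
        linear_combination sgn c x * sgn d x * sgn_mul_self a x
  simp_rw [e, mul_left_comm _ (380 : ℤ), ← Finset.mul_sum] at h
  exact nonneg_of_mul_nonneg_right h (by norm_num)

theorem sgn_eq_iff (u v : Fin 21 → Bool) (i : Fin 21) : sgn u i = sgn v i ↔ u i = v i := by
  unfold sgn; cases u i <;> cases v i <;> simp

theorem isPSD_diff (C : Finset (Fin 21 → Bool)) (a b : Fin 21 → Bool) :
    IsPSD C fun c d =>
      2 * hammingDist a b * (ipOf (hammingDist c d) - corr a b c d) -
        (ipOf (hammingDist a c) - ipOf (hammingDist b c)) *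
          (ipOf (hammingDist a d) - ipOf (hammingDist b d)) := by
  convert isPSD_variance C (fun c i => sgn a i * sgn c i - sgn b i * sgn c i)
    (Finset.univ.filter fun i => a i ≠ b i) ?_ using 4 with c d
  · rw [hammingDist, ← sum_sgn_mul_sgn c d, corr, ← Finset.sum_sub_distrib, mul_comm 2, mul_assoc,
      Finset.mul_sum]
    congr 1
    refine Finset.sum_congr rfl fun i _ => ?_
    linear_combination -(sgn c i * sgn d i) * (sgn_mul_self a i + sgn_mul_self b i)
  · simp_rw [Finset.sum_sub_distrib, sum_sgn_mul_sgn]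
  · intro c i hi
    have : a i = b i := by simpa using hi
    rw [(sgn_eq_iff a b i).2 this, sub_self]

theorem isPSD_agree (C : Finset (Fin 21 → Bool)) (a b : Fin 21 → Bool) :
    IsPSD C fun c d =>
      2 * (21 - hammingDist a b) * (ipOf (hammingDist c d) + corr a b c d) -
        (ipOf (hammingDist a c) + ipOf (hammingDist b c)) *
          (ipOf (hammingDist a d) + ipOf (hammingDist b d)) := by
  have hcard : ((Finset.univ.filter fun i => a i = b i).card : ℤ) = 21 - hammingDist a b := by
    have := Finset.card_filter_add_card_filter_not (s := (Finset.univ : Finset (Fin 21)))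
      (fun i => a i = b i)
    simp only [Finset.card_univ, Fintype.card_fin] at this
    rw [hammingDist, eq_sub_iff_add_eq]
    exact_mod_cast this
  convert isPSD_variance C (fun c i => sgn a i * sgn c i + sgn b i * sgn c i)
    (Finset.univ.filter fun i => a i = b i) ?_ using 4 with c d
  · rw [hcard, ← sum_sgn_mul_sgn c d, corr, ← Finset.sum_add_distrib, mul_comm 2, mul_assoc,
      Finset.mul_sum]
    congr 1
    refine Finset.sum_congr rfl fun i _ => ?_
    linear_combination -(sgn c i * sgn d i) * (sgn_mul_self a i + sgn_mul_self b i)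
  · simp_rw [Finset.sum_add_distrib, sum_sgn_mul_sgn]
  · intro c i hi
    have h : a i ≠ b i := by simpa using hi
    have : sgn a i = -sgn b i := by
      unfold sgn; revert h; cases a i <;> cases b i <;> simp
    rw [this]
    ring

/-- The quadruple function, positive semidefinite in `c`, `d` for fixed `a`, `b`. -/
def quadTerm (a b c d : Fin 21 → Bool) : ℤ :=
  quadConst (hammingDist a b) (hammingDist a c) (hammingDist a d) (hammingDist b c)
      (hammingDist b d) (hammingDist c d) +
    quadSlope (hammingDist a b) (hammingDist a c) (hammingDist a d) (hammingDist b c)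
      (hammingDist b d) * corr a b c d

theorem isPSD_one {α : Type*} (C : Finset α) : IsPSD C fun _ _ => 1 := fun g => by
  have h := isPSD_gram C (fun _ (_ : Unit) => 1) g
  simpa using h

theorem sum_quadTerm_nonneg (C : Finset (Fin 21 → Bool)) (a b : Fin 21 → Bool) :
    0 ≤ ∑ c ∈ C, ∑ d ∈ C, quadTerm a b c d := by
  by_cases hab : a = b
  · subst hab
    simpa [quadTerm, quadConst, quadSlope] using
      isPSD_centreKernel C a fun c => centreCoef (hammingDist a c)
  · have hne : Nat.beq (hammingDist a b) 0 = false := by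
      rw [← Bool.not_eq_true, Nat.beq_eq]
      exact hammingDist_ne_zero.2 hab
    let w (T : ℕ → List (ℕ × List ℤ)) (c : Fin 21 → Bool) : List ℤ :=
      assoc (T (hammingDist a b)) (100 * hammingDist a c + hammingDist b c)
    have h := add_nonneg (add_nonneg ((isPSD_one C).listDot (w tableConst))
      ((isPSD_diff C a b).listDot (w tableDiff))) ((isPSD_agree C a b).listDot (w tableAgree))
    simp_rw [← Finset.sum_add_distrib] at h
    refine h.trans_eq (Finset.sum_congr rfl fun c _ => Finset.sum_congr rfl fun d _ => ?_)
    simp only [w, quadTerm, quadConst, quadSlope, tableDot, hne, cond_false]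
    ring

section FourfoldSums

variable {α : Type*}

/-- The sum over all quadruples from `C`. -/
def sumFour (C : Finset α) (f : α → α → α → α → ℤ) : ℤ :=
  ∑ a ∈ C, ∑ b ∈ C, ∑ c ∈ C, ∑ d ∈ C, f a b c d

theorem sumFour_swap_left (C : Finset α) (f : α → α → α → α → ℤ) :
    sumFour C (fun a b c d => f b a c d) = sumFour C f :=
  Finset.sum_comm

theorem sumFour_swap_mid (C : Finset α) (f : α → α → α → α → ℤ) :
    sumFour C (fun a b c d => f a c b d) = sumFour C f :=
  Finset.sum_congr rfl fun _ _ => Finset.sum_comm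

theorem sumFour_swap_right (C : Finset α) (f : α → α → α → α → ℤ) :
    sumFour C (fun a b c d => f a b d c) = sumFour C f :=
  Finset.sum_congr rfl fun _ _ => Finset.sum_congr rfl fun _ _ => Finset.sum_comm

theorem sumFour_add (C : Finset α) (f g : α → α → α → α → ℤ) :
    sumFour C (fun a b c d => f a b c d + g a b c d) = sumFour C f + sumFour C g := by
  simp only [sumFour, Finset.sum_add_distrib]

theorem sumFour_mul (C : Finset α) (k : ℤ) (f : α → α → α → α → ℤ) :
    sumFour C (fun a b c d => k * f a b c d) = k * sumFour C f := by
  simp only [sumFour, Finset.mul_sum]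

/-- The sum over the six ways to split four positions into two ordered pairs. -/
def symSix (f : α → α → α → α → ℤ) (a b c d : α) : ℤ :=
  f a b c d + f a c b d + f a d b c + f b c a d + f b d a c + f c d a b

/-- The sum over the four choices of the last position. -/
def symFour (f : α → α → α → α → ℤ) (a b c d : α) : ℤ :=
  f a b c d + f a b d c + f a c d b + f b c d a

theorem sumFour_symSix (C : Finset α) (f : α → α → α → α → ℤ) :
    sumFour C (symSix f) = 6 * sumFour C f := by
  have h1 := sumFour_swap_mid C f
  have h2 := sumFour_swap_right C fun a b c d => f a c b d
  have h3 := sumFour_swap_left C fun a b c d => f a c b d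
  have h4 := sumFour_swap_left C fun a b c d => f a d b c
  have h5 := sumFour_swap_mid C fun a b c d => f b d a c
  unfold symSix
  simp only [sumFour_add]
  linarith

theorem sumFour_symFour (C : Finset α) (f : α → α → α → α → ℤ) :
    sumFour C (symFour f) = 4 * sumFour C f := by
  have h1 := sumFour_swap_right C f
  have h2 := sumFour_swap_mid C fun a b c d => f a b d c
  have h3 := sumFour_swap_left C fun a b c d => f a c d b
  unfold symFour
  simp only [sumFour_add]
  linarith

end FourfoldSums

/-- The multiplier term of the triple `a`, `b`, `c` and the word `d`. -/
def multTerm (a b c d : Fin 21 → Bool) : ℤ :=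
  tripleTerm (hammingDist a b) (hammingDist a c) (hammingDist b c)
    (hammingDist a d) (hammingDist b d) (hammingDist c d)

theorem sum_eqInd {C : Finset (Fin 21 → Bool)} {a : Fin 21 → Bool} (ha : a ∈ C) :
    ∑ d ∈ C, eqInd (hammingDist a d) = 1 := by
  rw [Finset.sum_eq_single_of_mem a ha]
  · simp [eqInd]
  · intro d _ hd
    have h : Nat.beq (hammingDist a d) 0 = false := by
      rw [← Bool.not_eq_true, Nat.beq_eq]
      exact hammingDist_ne_zero.2 hd.symm
    simp [eqInd, h]

theorem sumFour_multTerm {C : Finset (Fin 21 → Bool)} (hC : C.card = 48) :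
    sumFour C multTerm = 0 := by
  refine Finset.sum_eq_zero fun a ha => Finset.sum_eq_zero fun b hb =>
    Finset.sum_eq_zero fun c hc => ?_
  simp only [multTerm, tripleTerm]
  rw [← Finset.mul_sum, Finset.sum_sub_distrib, ← Finset.mul_sum, Finset.sum_add_distrib,
    Finset.sum_add_distrib, sum_eqInd ha, sum_eqInd hb, sum_eqInd hc]
  simp [hC]

theorem total_eq (a b c d : Fin 21 → Bool) :
    2 * symSix quadTerm a b c d + symFour multTerm a b c d =
      totalConst (hammingDist a b) (hammingDist a c) (hammingDist a d) (hammingDist b c)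
          (hammingDist b d) (hammingDist c d) +
        totalSlope (hammingDist a b) (hammingDist a c) (hammingDist a d) (hammingDist b c)
          (hammingDist b d) (hammingDist c d) * corr a b c d := by
  have e1 : corr a c b d = corr a b c d := corr_swap_mid a b c d
  have e2 : corr a d b c = corr a b c d := by rw [corr_swap_mid, corr_swap_right]
  have e3 : corr b c a d = corr a b c d := by rw [corr_swap_mid, corr_swap_left]
  have e4 : corr b d a c = corr a b c d := by rw [corr_swap_mid, corr_swap_left, corr_swap_right]
  have e5 : corr c d a b = corr a b c d := by
    rw [corr_swap_mid, corr_swap_left, corr_swap_right, corr_swap_mid]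
  simp only [symSix, symFour, quadTerm, multTerm, totalConst, totalSlope, e1, e2, e3, e4, e5,
    hammingDist_comm b a, hammingDist_comm c a, hammingDist_comm d a, hammingDist_comm c b,
    hammingDist_comm d b, hammingDist_comm d c]
  ring

/-- The number of coordinates in which `b`, `c`, `d` differ from `a` in the pattern `p`, `q`, `r`. -/
def region (a b c d : Fin 21 → Bool) (p q r : Bool) : ℕ :=
  ∑ i, if (a i ^^ b i) = p ∧ (a i ^^ c i) = q ∧ (a i ^^ d i) = r then 1 else 0

theorem sum_pattern (a b c d : Fin 21 → Bool) (φ : Bool → Bool → Bool → ℤ) :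
    ∑ i, φ (a i ^^ b i) (a i ^^ c i) (a i ^^ d i) =
      ∑ p, ∑ q, ∑ r, φ p q r * region a b c d p q r := by
  simp only [region, Fintype.sum_bool]
  push_cast
  simp_rw [Finset.mul_sum, ← Finset.sum_add_distrib]
  refine Finset.sum_congr rfl fun i _ => ?_
  generalize (a i ^^ b i) = p
  generalize (a i ^^ c i) = q
  generalize (a i ^^ d i) = r
  cases p <;> cases q <;> cases r <;> simp

/-- Weighted sums over coordinates depend only on the eight regions. -/
theorem sum_eq_of_pattern {a b c d : Fin 21 → Bool} {f : Fin 21 → ℤ} (φ : Bool → Bool → Bool → ℤ)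
    (h : ∀ i, f i = φ (a i ^^ b i) (a i ^^ c i) (a i ^^ d i)) :
    ∑ i, f i = ∑ p, ∑ q, ∑ r, φ p q r * region a b c d p q r := by
  rw [← sum_pattern]
  exact Finset.sum_congr rfl fun i _ => h i

theorem hammingDist_eq_of_pattern {a b c d u v : Fin 21 → Bool} (φ : Bool → Bool → Bool → ℤ)
    (h : ∀ i, (if u i ≠ v i then 1 else 0 : ℤ) = φ (a i ^^ b i) (a i ^^ c i) (a i ^^ d i)) :
    (hammingDist u v : ℤ) = ∑ p, ∑ q, ∑ r, φ p q r * region a b c d p q r := by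
  rw [hammingDist_eq_sum, ← sum_eq_of_pattern φ h]
  push_cast
  rfl

theorem affine_neg_of_endpoints {P Q t lo hi s n : ℤ} (hlo : lo ≤ n) (hhi : n ≤ hi)
    (ht : t = 21 - 2 * s + 8 * n) (h1 : P + Q * (21 - 2 * s + 8 * lo) < 0)
    (h2 : P + Q * (21 - 2 * s + 8 * hi) < 0) : P + Q * t < 0 := by
  subst ht
  rcases le_total 0 Q with hQ | hQ <;> nlinarith

theorem checkQuad_of_mem {ab ac ad bc bd cd : ℕ} (hab : ab ∈ dists) (hac : ac ∈ dists)
    (had : ad ∈ dists) (hbc : bc ∈ dists) (hbd : bd ∈ dists) (hcd : cd ∈ dists)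
    (t1 : isTri ab ac bc = true) (t2 : isTri ab ad bd = true) (t3 : isTri ac ad cd = true)
    (t4 : isTri bc bd cd = true) :
    checkQuad ab ac ad bc bd cd
      (max (max (agree ab ac bc + agree ab ad bd + ab - 21)
        (agree ab ac bc + agree ac ad cd + ac - 21)) (agree ab ad bd + agree ac ad cd + ad - 21))
      (min (min (agree ab ac bc) (agree ab ad bd)) (min (agree ac ad cd) (agree bc bd cd)))
      (agree ab ac bc + agree ab ad bd + agree ac ad cd + agree bc bd cd) = true := by
  have key := checkAll_eq_true
  simp only [checkAll, List.all_eq_true, Bool.or_eq_true, Bool.not_eq_true'] at key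
  have h := (key ab hab ac hac bc hbc).resolve_left (by simp [t1])
  have h' := (h ad had bd hbd).resolve_left (by simp [t2])
  exact (h' cd hcd).resolve_left (by simp [t3, t4])

theorem isTri_eq_true {x y z : ℕ} (h1 : x ≤ y + z) (h2 : y ≤ x + z) (h3 : z ≤ x + y)
    (h4 : x + y + z ≤ 42) : isTri x y z = true := by
  simp only [isTri, Bool.and_eq_true, Nat.ble_eq]
  exact ⟨⟨⟨h1, h2⟩, h3⟩, h4⟩

theorem checkQuad_of_regions {ab ac ad bc bd cd n na nb nc nd ib ic id : ℕ}
    (hab : ab ∈ dists) (hac : ac ∈ dists) (had : ad ∈ dists) (hbc : bc ∈ dists)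
    (hbd : bd ∈ dists) (hcd : cd ∈ dists)
    (h_sum : n + na + nb + nc + nd + ib + ic + id = 21)
    (h_ab : ab = na + nb + ic + id) (h_ac : ac = na + nc + ib + id)
    (h_ad : ad = na + nd + ib + ic) (h_bc : bc = nb + nc + ib + ic)
    (h_bd : bd = nb + nd + ib + id) (h_cd : cd = nc + nd + ic + id) :
    ∃ lo hi, lo ≤ n ∧ n ≤ hi ∧
      checkQuad ab ac ad bc bd cd lo hi ((n + nd) + (n + nc) + (n + nb) + (n + na)) = true := by
  have l1 : n + nd + (n + nc) + ab - 21 ≤ n := by omega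
  have l2 : n + nd + (n + nb) + ac - 21 ≤ n := by omega
  have l3 : n + nc + (n + nb) + ad - 21 ≤ n := by omega
  have h := checkQuad_of_mem hab hac had hbc hbd hcd
    (isTri_eq_true (by omega) (by omega) (by omega) (by omega))
    (isTri_eq_true (by omega) (by omega) (by omega) (by omega))
    (isTri_eq_true (by omega) (by omega) (by omega) (by omega))
    (isTri_eq_true (by omega) (by omega) (by omega) (by omega))
  have n1 : agree ab ac bc = n + nd := by unfold agree; omega
  have n2 : agree ab ad bd = n + nc := by unfold agree; omega
  have n3 : agree ac ad cd = n + nb := by unfold agree; omega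
  have n4 : agree bc bd cd = n + na := by unfold agree; omega
  rw [n1, n2, n3, n4] at h
  exact ⟨_, _, max_le (max_le l1 l2) l3,
    le_min (le_min (Nat.le_add_right _ _) (Nat.le_add_right _ _))
      (le_min (Nat.le_add_right _ _) (Nat.le_add_right _ _)), h⟩

theorem total_neg (a b c d : Fin 21 → Bool)
    (hab : hammingDist a b ∈ dists) (hac : hammingDist a c ∈ dists)
    (had : hammingDist a d ∈ dists) (hbc : hammingDist b c ∈ dists)
    (hbd : hammingDist b d ∈ dists) (hcd : hammingDist c d ∈ dists) :
    totalConst (hammingDist a b) (hammingDist a c) (hammingDist a d) (hammingDist b c)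
          (hammingDist b d) (hammingDist c d) +
        totalSlope (hammingDist a b) (hammingDist a c) (hammingDist a d) (hammingDist b c)
          (hammingDist b d) (hammingDist c d) * corr a b c d < 0 := by
  have h_sum : (21 : ℤ) = ∑ p, ∑ q, ∑ r, (1 : ℤ) * region a b c d p q r := by
    rw [← sum_eq_of_pattern (f := fun _ => 1) (fun _ _ _ => 1) fun _ => rfl]
    simp
  have h_ab := hammingDist_eq_of_pattern (a := a) (b := b) (c := c) (d := d) (u := a) (v := b)
    (fun p _ _ => bif p then 1 else 0) fun i => by cases a i <;> cases b i <;> simp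
  have h_ac := hammingDist_eq_of_pattern (a := a) (b := b) (c := c) (d := d) (u := a) (v := c)
    (fun _ q _ => bif q then 1 else 0) fun i => by cases a i <;> cases c i <;> simp
  have h_ad := hammingDist_eq_of_pattern (a := a) (b := b) (c := c) (d := d) (u := a) (v := d)
    (fun _ _ r => bif r then 1 else 0) fun i => by cases a i <;> cases d i <;> simp
  have h_bc := hammingDist_eq_of_pattern (a := a) (b := b) (c := c) (d := d) (u := b) (v := c)
    (fun p q _ => bif p ^^ q then 1 else 0) fun i => by
      cases a i <;> cases b i <;> cases c i <;> simp
  have h_bd := hammingDist_eq_of_pattern (a := a) (b := b) (c := c) (d := d) (u := b) (v := d)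
    (fun p _ r => bif p ^^ r then 1 else 0) fun i => by
      cases a i <;> cases b i <;> cases d i <;> simp
  have h_cd := hammingDist_eq_of_pattern (a := a) (b := b) (c := c) (d := d) (u := c) (v := d)
    (fun _ q r => bif q ^^ r then 1 else 0) fun i => by
      cases a i <;> cases c i <;> cases d i <;> simp
  have h_corr : corr a b c d = _ :=
    sum_eq_of_pattern (a := a) (b := b) (c := c) (d := d)
      (fun p q r => bif p ^^ q ^^ r then -1 else 1) fun i => by
      unfold sgn; cases a i <;> cases b i <;> cases c i <;> cases d i <;> simp
  simp only [Fintype.sum_bool, Bool.xor_true, Bool.xor_false, Bool.not_true, Bool.not_false,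
    cond_true, cond_false] at h_sum h_ab h_ac h_ad h_bc h_bd h_cd h_corr
  obtain ⟨lo, hi, h_lo, h_hi, h⟩ := checkQuad_of_regions (n := region a b c d false false false)
    (na := region a b c d true true true) (nb := region a b c d true false false)
    (nc := region a b c d false true false) (nd := region a b c d false false true)
    (ib := region a b c d false true true) (ic := region a b c d true false true)
    (id := region a b c d true true false) hab hac had hbc hbd hcd (by omega) (by omega)
    (by omega) (by omega) (by omega) (by omega) (by omega)
  have hle : Nat.ble lo hi = true := Nat.ble_eq_true_of_le (h_lo.trans h_hi)
  simp only [checkQuad, hle, Bool.not_true, Bool.false_or, Bool.and_eq_true,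
    decide_eq_true_eq] at h
  exact affine_neg_of_endpoints (Int.ofNat_le.2 h_lo) (Int.ofNat_le.2 h_hi)
    (by rw [h_corr]; push_cast; omega) h.1 h.2

/-- There is no code of size 48 with distances in `{10, 12, …, 20}`. -/
theorem card_ne_of_dists {C : Finset (Fin 21 → Bool)}
    (h : ∀ u ∈ C, ∀ v ∈ C, hammingDist u v ∈ dists) : C.card ≠ 48 := by
  intro hC
  have h_zero : sumFour C (fun a b c d => 2 * symSix quadTerm a b c d +
      symFour multTerm a b c d) = 12 * sumFour C quadTerm := by
    rw [sumFour_add, sumFour_mul, sumFour_symSix, sumFour_symFour, sumFour_multTerm hC]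
    ring
  have h_nonneg : 0 ≤ sumFour C quadTerm :=
    Finset.sum_nonneg fun a _ => Finset.sum_nonneg fun b _ => sum_quadTerm_nonneg C a b
  have hne : C.Nonempty := Finset.card_pos.1 (by omega)
  have h_neg : sumFour C (fun a b c d => 2 * symSix quadTerm a b c d +
      symFour multTerm a b c d) < 0 := by
    refine Finset.sum_neg (fun a ha => ?_) hne
    refine Finset.sum_neg (fun b hb => ?_) hne
    refine Finset.sum_neg (fun c hc => ?_) hne
    refine Finset.sum_neg (fun d hd => ?_) hne
    exact (total_eq a b c d).trans_lt <| total_neg a b c d (h a ha b hb) (h a ha c hc) (h a ha d hd) (h b hb c hc)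
      (h b hb d hd) (h c hc d hd)
  linarith

/-- Replace the first coordinate by the parity of the others. -/
def evenize (u : Fin 21 → Bool) : Fin 21 → Bool :=
  Fin.cons (decide (Odd (∑ i : Fin 20, (u i.succ).toNat))) (Fin.tail u)

theorem even_sum_evenize (u : Fin 21 → Bool) : Even (∑ i, (evenize u i).toNat) := by
  rw [Fin.sum_univ_succ]
  simp only [evenize, Fin.cons_zero, Fin.cons_succ, Fin.tail]
  by_cases h : Odd (∑ i : Fin 20, (u i.succ).toNat)
  · simpa only [h, decide_true, Bool.toNat_true] using odd_one.add_odd h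
  · simpa only [h, decide_false, Bool.toNat_false, zero_add] using Nat.not_odd_iff_even.1 h

theorem even_hammingDist {u v : Fin 21 → Bool} (hu : Even (∑ i, (u i).toNat))
    (hv : Even (∑ i, (v i).toNat)) : Even (hammingDist u v) := by
  have h : hammingDist u v + 2 * ∑ i, (u i && v i).toNat =
      ∑ i, (u i).toNat + ∑ i, (v i).toNat := by
    rw [hammingDist_eq_sum, Finset.mul_sum, ← Finset.sum_add_distrib, ← Finset.sum_add_distrib]
    refine Finset.sum_congr rfl fun i _ => ?_
    cases u i <;> cases v i <;> simp
  have h2 := hu.add hv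
  rw [← h] at h2
  exact (Nat.even_add.1 h2).2 (even_two_mul _)

theorem ten_le_hammingDist_evenize {u v : Fin 21 → Bool} (h : 10 ≤ hammingDist u v) :
    10 ≤ hammingDist (evenize u) (evenize v) := by
  obtain ⟨k, hk⟩ := even_hammingDist (even_sum_evenize u) (even_sum_evenize v)
  rw [hammingDist_eq_sum, Fin.sum_univ_succ] at h hk ⊢
  simp only [evenize, Fin.cons_succ, Fin.tail] at hk ⊢
  have h_le : ∀ (p : Prop) [Decidable p], (if p then 1 else 0) ≤ 1 := fun p _ => by
    split_ifs <;> simp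
  have := h_le (u 0 ≠ v 0)
  omega

theorem mem_dists_of_even {n : ℕ} (h : Even n) (h21 : n ≤ 21) (h10 : n = 0 ∨ 10 ≤ n) :
    n ∈ dists := by
  obtain ⟨k, rfl⟩ := h
  simp only [dists, List.mem_cons, List.not_mem_nil, or_false]
  omega

/-- `A(21,10) ≤ 47`: every binary code of length 21 in which any two distinct
codewords have Hamming distance at least 10 has at most 47 codewords. -/
theorem A_21_10_le_47 (C : Finset (Fin 21 → Bool))
    (hC : ∀ u ∈ C, ∀ v ∈ C, u ≠ v → 10 ≤ hammingDist u v) :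
    C.card ≤ 47 := by
  by_contra! hcard
  have h_even : ∀ u ∈ C, ∀ v ∈ C, u ≠ v → 10 ≤ hammingDist (evenize u) (evenize v) :=
    fun u hu v hv huv => ten_le_hammingDist_evenize (hC u hu v hv huv)
  have h_inj : Set.InjOn evenize C := fun u hu v hv huv => by
    by_contra hne
    have := h_even u hu v hv hne
    rw [huv, hammingDist_self] at this
    omega
  obtain ⟨D, hD, hD48⟩ := Finset.exists_subset_card_eq
    (show 48 ≤ (C.image evenize).card by rwa [Finset.card_image_of_injOn h_inj])
  refine card_ne_of_dists (fun x hx y hy => ?_) hD48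
  obtain ⟨u, hu, rfl⟩ := Finset.mem_image.1 (hD hx)
  obtain ⟨v, hv, rfl⟩ := Finset.mem_image.1 (hD hy)
  refine mem_dists_of_even (even_hammingDist (even_sum_evenize u) (even_sum_evenize v))
    (hammingDist_le_card_fintype.trans_eq (Fintype.card_fin 21)) ?_
  rcases eq_or_ne u v with rfl | huv
  · exact Or.inl (hammingDist_self _)
  · exact Or.inr (h_even u hu v hv huv)
end

section
/- A(22,10) ≤ 84. That is, every binary code of length 22 in which any two distinct codewords have Hamming distance at least 10 has at most 84 codewords. -/
/-- The columns of a factorization of the matrices in `gramTables`. -/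
def factorTables : List (List (List ℤ)) :=
  [[[234391286],
    [-1727689, 611397],
    [-1091381, -4753, 937724],
    [-1087299, -896530, 1148867, 3842],
    [-1666020, -3366766, -4720637, 8339, 22058],
    [-269529, -685335, -20879286, 74705, 89859, 106427],
    [4310738, 3879720, -45663899, 166054, 204999, -206803, 6105252],
    [13274281, 23410227, -83432217, 183119, 176020, -181883, -65790, 1461937],
    [-8392660514, -363724414, 1269308442, -14954769, -13934633, -5603, -363, -185, 219686]],
   [[],
    [245336],
    [373813, 342668],
    [308538, 774590, 227437],
    [264887, 1721150, -314406, 9345],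
    [140735, 2649504, -719547, 14537, 18064],
    [1649010, 3479771, 752231, 10639, -9484, 1224281]],
   [[51514337],
    [-1005356, 387116],
    [-2121224, 964002, 870048],
    [-1795413, -70102, 1552444, 241801],
    [197098, -1428668, 4394199, -3083179, 53616],
    [9294630, -272925, 10512630, -4484767, 59548, 125755],
    [33143070, -1663502, 12836573, -3864900, 47814, -35891, 7311787]],
   [[],
    [198486],
    [224010, 246514],
    [210431, 293025, 330233],
    [426492, 990518, 753685, 1242],
    [880247, 2183102, 1180323, -1788, 28632],
    [487338, 4464808, 1044905, -7505, -12266, 1580575]],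
   [[43916738],
    [-659718, 893439],
    [-298444, 616003, 731294],
    [453970, 680287, 1261022, 750157],
    [1277768, -191033, 1400857, -447624, 598494],
    [2164255, -2560682, -1402841, -5050823, 3289911, 787365],
    [3142126, -2559872, -13438984, -14945200, 5976671, -1007093, 5868753],
    [],
    [],
    [355423, -250978, 124556, 205788, -233615, -29619, 16, 4492],
    [-199527, -645309, 308875, 329936, -499073, 23355, -71, 1438, 6555],
    [-986652, -1128461, 38087, 408054, -37807, 42197, -37, -4706, 1580, 664],
    [-1896714, -2339556, -1570180, 1567735, -136022, 624498, -664, -50379, 39223, 17319, 5096],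
    [-2070947, -4328332, -4362779, 2575347, -519924, 4697616, -5300, -309990, 302913, 126260,
     39551, 55931],
    [-1431014, -8797628, -8059535, 4182301, 1316631, 8280066, 19659, -569299, 512303, 235691,
     77426, 69874, 1170946],
    [775002, -12321299, -13702077, 3127974, 11088787, 11273648, -11751, -812034, 590183, 324325,
     100187, 96742, 22805, 368085]],
   [[],
    [58289],
    [43569, 115070],
    [48512, 151577, 161227],
    [72839, 426946, 125510, 174844],
    [-760507, 372917, 342558, -305050, 31080],
    [],
    [],
    [],
    [40595, -28756, 34689, 12981, -233, 590],
    [51088, 5246, 152299, 58304, -678, 1590, 313],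
    [17989, 129667, 197735, 56974, -552, 1378, 161, 226],
    [24120, 436766, 330278, 166543, -643, 1594, 259, 370, 70],
    [2441, 848762, 535884, 107593, 3084, 472, 184, 1014, 93, 4132],
    [-206162, 1191593, 1179642, 98435, -138, 3630, 43, 3530, -348, 611, 174449]],
   [[10160410],
    [-199645, 308754],
    [-369995, 213712, 496459],
    [-246734, -94134, 523755, 705802],
    [-304581, -48457, 1754095, 1746422, 1104426],
    [-2156016, 1107414, 4705866, 3246769, 3025411, 2246687],
    [],
    [],
    [],
    [-115830, -19986, 4746, 39282, 4251, -6542, 479],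
    [-111851, -161358, -9850, 40757, -89788, 1965, -68, 238],
    [-122947, -218346, 52586, 11194, -95188, 7841, -596, 149, 189],
    [63472, -334397, -24410, -177627, 246166, 24937, -1788, -274, -339, 83],
    [812101, -464321, -90459, -376244, 1122569, 185354, -4632, -16, -3261, 289, 10223],
    [2274923, 425093, -1693664, -1186394, 2549116, 184028, -12229, -6995, 1364, 3092, 2475,
     426970]],
   [[],
    [8540],
    [-21807, 15344],
    [-6027, 42661, 691],
    [-30240, 110826, 1789, 139],
    [219973, 636495, 3493, -164, 27815],
    [],
    [],
    [],
    [-1618, -3803, -118, -10, 1, 38],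
    [-201, 18086, 281, 10, -1, 22, 45],
    [-13051, 30499, 446, 27, 1, 27, 13, 27],
    [-37666, 99760, 1579, 94, 1, 11, 32, 73, 23],
    [-112439, 187765, 2662, 104, 223, 217, 18, 144, 31, 1161],
    [-194172, 216925, 2536, 133, 334, 617, -33, 189, 75, 463, 98153]],
   [[2532631],
    [9026, 100566],
    [43097, 12009, 172028],
    [255222, -45797, 117918, 172347],
    [346687, -1405, 642965, 222190, 464274],
    [179356, -1504157, 677903, -529132, 2067030, 433167],
    [],
    [],
    [],
    [-12747, -15179, -6050, 19028, -1037, 7686, 2192],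
    [-4001, -6227, -18265, 27398, 1246, 15559, 4435, 90],
    [8839, -20390, 31438, 28588, 17196, 9556, 2726, 80, 62],
    [79560, -45744, 174321, 131674, 108352, 34964, 9947, 201, 150, 262],
    [170389, 82544, 485230, 284915, 214350, 80130, 19829, 151, 306, 944, 3297],
    [25096, -355944, 702568, 1211087, 299640, 649790, 182405, 2163, 598, 4248, -394, 295284],
    [],
    [],
    [-20075, -104680, 52297, -44880, -14946, -76520, -21808, -359, -223, -235, -4, 0, 117],
    [-121033, -50472, 47589, -162861, -11689, -112506, -32028, -561, -150, -338, -3, 0, 88, 147],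
    [-247688, 36719, -54269, -199965, -27225, -62897, -17919, -145, -108, -173, -1, 0, -6, 8, 32],
    [-467618, 154526, -210941, -274821, -108502, -24734, -7066, 141, 35, 206, 7, 0, -151, -11,
     -34, 21],
    [-768591, 232082, -342814, -294225, -103883, 75666, 21611, 425, 430, 794, -175, 1, -175,
     -199, 3, 27, 1923],
    [-1031360, 363947, -291409, -330421, -24623, 103561, 29385, 1009, 580, 1086, 86, -285, 514,
     41, 0, 427, 761, 53356],
    [-1132328, 823930, -351919, -119076, 54338, 236566, 67390, 1384, 387, 2823, 288, 11, -600,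
     -279, -850, 862, -531, -82, 12719]],
   [[],
    [1634],
    [1490, 61],
    [-7806, -7, 67],
    [-28775, -13, 226, 82],
    [],
    [],
    [],
    [],
    [1658, -1, -6, -3, 7],
    [-2357, -3, 23, -1, 13, 15],
    [-8136, -7, 66, 7, 3, 5, 11],
    [-27669, -20, 203, 22, 3, 14, 33, 8],
    [-48827, -18, 348, 41, 12, 35, 58, 13, 539],
    [],
    [],
    [],
    [1686, -2, -11, -5, 14, 1, 1, 1, 0, 4],
    [-10744, -34, 91, 5, -14, -24, 31, -6, -1, 4, 48],
    [-8259, -8, 63, 5, 9, 6, 12, 3, 0, 1, 1, 6],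
    [-27875, -21, 201, 22, 6, 14, 35, 9, 0, 1, 1, 7, 5],
    [-52432, -49, 400, 49, 10, 19, 69, 14, -10, -8, -1, 9, 4, 229],
    [-66500, -67, 506, 56, 37, 19, 89, 0, -6, -60, -7, 21, 2, 2, 9301]]]

/-- The positive semidefinite matrices of the dual certificate: the entry with index `2 * a + k`
belongs to subsets of size `a` and to degree `k`. -/
def gramTables : List (List (List ℤ)) :=
  [[[54939274952733796, -404955246518054, -255810196105966, -254853410876514, -390500570301720,
     -63175248924294, 1010399423429068, 3111375794315366, -1967166490837881004],
    [-404955246518054, 3358715572330, 1882660978568, 1330378769601, 819933795678, 46650525486,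
     -5075565455642, -8620886709490, 14277527235225788],
    [-255810196105966, 1882660978568, 2070461378346, 2268238835717, -2592389797770,
     -19281591358260, -47543231884214, -92834959135100, 10351579996035584],
    [-254853410876514, 1330378769601, 2268238835717, 3305895300954, -593483427881,
     -23079753652631, -60626455161227, -131272900574270, 10909630358707822],
    [-390500570301720, 819933795678, -2592389797770, -593483427881, 36395705719210,
     101322538381189, 195324712667631, 292926646293228, 9214538786288445],
    [-63175248924294, 46650525486, -19281591358260, -23079753652631, 101322538381189,
     436511895997097, 949617646933842, 1722393608376402, -23993285460301189],
    [1010399423429068, -5075565455642, -47543231884214, -60626455161227, 195324712667631,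
     949617646933842, 2156212829250475, 3957589844847276, -95556622920149930],
    [3111375794315366, -8620886709490, -92834959135100, -131272900574270, 292926646293228,
     1722393608376402, 3957589844847276, 7687419282943898, -225827812974429623],
    [-1967166490837881004, 14277527235225788, 10351579996035584, 10909630358707822,
     9214538786288445, -23993285460301189, -95556622920149930, -225827812974429623,
     72180607740933041205]],
   [[0, 0, 0, 0, 0, 0, 0],
    [0, 60189752896, 91709786168, 75695478768, 64986317032, 34527361960, 404561517360],
    [0, 91709786168, 257157517193, 380762721514, 688801232331, 960508809227, 1808827544158],
    [0, 75695478768, 380762721514, 746912954513, 1343405726284, 1932049787751, 3375263228217],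
    [0, 64986317032, 688801232331, 1343405726284, 3131460907130, 4823838423892, 6189602650189],
    [0, 34527361960, 960508809227, 1932049787751, 4823838423892, 7557963303915, 8910458386744],
    [0, 404561517360, 1808827544158, 3375263228217, 6189602650189, 8910458386744, 16892958771440]],
   [[2653726916549569, -51790247788972, -109273447988488, -92489510336181, 10153372794026,
     478806702110310, 1707343277194590],
    [-51790247788972, 1160599484192, 2505765873976, 1777891626196, -751213898376,
     -9450065672580, -33964552523152],
    [-109273447988488, 2505765873976, 6185874636484, 5091595474620, 2027836234264,
     -10832599766730, -60739060107180],
    [-92489510336181, 1777891626196, 5091595474620, 5696972227710, 5822512279639,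
     -1432718721487, -40395359871194],
    [10153372794026, -751213898376, 2027836234264, 5822512279639, 30897792148926,
     62246992590871, 77234223238747],
    [478806702110310, -9450065672580, -10832599766730, -1432718721487, 62246992590871,
     217112519738043, 460784236148107],
    [1707343277194590, -33964552523152, -60739060107180, -40395359871194, 77234223238747,
     460784236148107, 1334411189799079]],
   [[0, 0, 0, 0, 0, 0, 0],
    [0, 39396692196, 44462848860, 41767607466, 84652691112, 174716706042, 96729770268],
    [0, 44462848860, 110949632296, 119373413160, 339715027172, 735349336898, 1209806264692],
    [0, 41767607466, 119373413160, 239198690675, 628885333607, 1214716325266, 1755913499743],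
    [0, 84652691112, 339715027172, 628885333607, 1731063956177, 3427409649919, 5417838352555],
    [0, 174716706042, 735349336898, 1214716325266, 3427409649919, 6934754496110, 11409096710045],
    [0, 96729770268, 1209806264692, 1755913499743, 5417838352555, 11409096710045, 23762259372539]],
   [[1928679876560644, -28972662559884, -13106686955672, 19936881549860, 56115402480784,
     95047019800190, 137991924304988, 0, 0, 15609018770174, -8762574982926, -43330537381176,
     -83297491798932, -90949236810886, -62845466912332, 34035559783476],
    [-28972662559884, 1233461086245, 747249983109, 308302756533, -1013642881911, -3715611145488,
     -4360006560276, 0, 0, -458712484056, -444912674265, -357298983243, -838954206432,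
     -2500859600802, -6916078268640, -11519611826697],
    [-13106686955672, 747249983109, 1003319431581, 1205752032649, 525419224867, -3249185919520,
     -12342485848856, 0, 0, -169590007282, -112086209689, -372822197317, -2023373814572,
     -5238677896554, -10886177286958, -17841498542423],
    [19936881549860, 308302756533, 1205752032649, 2821791172402, 1880834291375, -6317415426097,
     -28473117581092, 0, 0, 302055473572, 107427374329, -861454647355, -3256604926717,
     -7454301521533, -13660417958329, -22962340825649],
    [56115402480784, -1013642881911, 525419224867, 1880834291375, 4190147316774, 5519272501195,
     -4055334788470, 0, 0, 444645537108, -145363663790, -1197066648318, -4959389859772,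
     -9394923580927, -12522225197633, -10614186759584],
    [95047019800190, -3715611145488, -3249185919520, -6317415426097, 5519272501195,
     50163325889905, 126563463598314, 0, 0, -594123697459, -2502663860778, -1451332511739,
     -3785545341675, 1702322572573, 20464065488869, 82008821083060],
    [137991924304988, -4360006560276, -12342485848856, -28473117581092, -4055334788470,
     126563463598314, 491568288776415, 0, 0, -4356510512640, -11063688688615, -7090441857247,
     -3745022861080, 16845585398126, 63476659917582, 226221354779258],
    [0, 0, 0, 0, 0, 0, 0, 0, 0, 0, 0, 0, 0, 0, 0, 0],
    [0, 0, 0, 0, 0, 0, 0, 0, 0, 0, 0, 0, 0, 0, 0, 0],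
    [15609018770174, -458712484056, -169590007282, 302055473572, 444645537108, -594123697459,
     -4356510512640, 0, 0, 302651795199, 313316626859, 28817961404, 53140476022, 317749917503,
     1000810705507, -623216872893],
    [-8762574982926, -444912674265, -112086209689, 107427374329, -145363663790, -2502663860778,
     -11063688688615, 0, 0, 313316626859, 910160615195, 1091323135867, 2003099831845,
     3079200818351, 4392041303822, -671902857791],
    [-43330537381176, -357298983243, -372822197317, -861454647355, -1197066648318,
     -1451332511739, -7090441857247, 0, 0, 28817961404, 1091323135867, 2418100125269,
     5123216563032, 8032276854701, 13042594466405, 13955409475710],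
    [-83297491798932, -838954206432, -2023373814572, -3256604926717, -4959389859772,
     -3785545341675, -3745022861080, 0, 0, 53140476022, 2003099831845, 5123216563032,
     14407207119288, 27976442037956, 47553460077324, 59377218634942],
    [-90949236810886, -2500859600802, -5238677896554, -7454301521533, -9394923580927,
     1702322572573, 16845585398126, 0, 0, 317749917503, 3079200818351, 8032276854701,
     27976442037956, 71235961523146, 125555762581607, 167235261106693],
    [-62845466912332, -6916078268640, -10886177286958, -13660417958329, -12522225197633,
     20464065488869, 63476659917582, 0, 0, 1000810705507, 4392041303822, 13042594466405,
     47553460077324, 125555762581607, 234211299855163, 339632126915459],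
    [34035559783476, -11519611826697, -17841498542423, -22962340825649, -10614186759584,
     82008821083060, 226221354779258, 0, 0, -623216872893, -671902857791, 13955409475710,
     59377218634942, 167235261106693, 339632126915459, 601270952032337]],
   [[0, 0, 0, 0, 0, 0, 0, 0, 0, 0, 0, 0, 0, 0, 0],
    [0, 3397607521, 2539593441, 2827715968, 4245712471, -44329192523, 0, 0, 0, 2366241955,
     2977868432, 1048560821, 1405930680, 142283449, -12016976818],
    [0, 2539593441, 15139362661, 19555584718, 52302198611, 9777029707, 0, 0, 0, -1540269365,
     2829510292, 15704544431, 51309547900, 97773395269, 128134334332],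
    [0, 2827715968, 19555584718, 51323146602, 88484360180, 74861523191, 0, 0, 0, 3203399831,
     27828264871, 52407438072, 120623520528, 215170185134, 360806901951],
    [0, 4245712471, 52302198611, 88484360180, 233911591273, 93479144489, 0, 0, 0, -2696893617,
     35270109614, 91450389659, 258804609388, 448624132183, 658996867620],
    [0, -44329192523, 9777029707, 74861523191, 93479144489, 928805438202, 0, 0, 0, -33680484145,
     -2531925632, 85012899486, 206849482116, 465507338509, 975216849361],
    [0, 0, 0, 0, 0, 0, 0, 0, 0, 0, 0, 0, 0, 0, 0],
    [0, 0, 0, 0, 0, 0, 0, 0, 0, 0, 0, 0, 0, 0, 0],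
    [0, 0, 0, 0, 0, 0, 0, 0, 0, 0, 0, 0, 0, 0, 0],
    [0, 2366241955, -1540269365, 3203399831, -2696893617, -33680484145, 0, 0, 0, 3847097032,
     7964103693, 4601309748, 2039506808, -4322402960, -434034771],
    [0, 2977868432, 2829510292, 27828264871, 35270109614, -2531925632, 0, 0, 0, 7964103693,
     29234931830, 35038525644, 63537700671, 92463727968, 181122022543],
    [0, 1048560821, 15704544431, 52407438072, 91450389659, 85012899486, 0, 0, 0, 4601309748,
     35038525644, 59484582496, 131866849601, 222192566561, 389672270892],
    [0, 1405930680, 51309547900, 120623520528, 258804609388, 206849482116, 0, 0, 0, 2039506808,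
     63537700671, 131866849601, 328169604455, 565678016065, 921485309310],
    [0, 142283449, 97773395269, 215170185134, 448624132183, 465507338509, 0, 0, 0, -4322402960,
     92463727968, 222192566561, 565678016065, 1019178684195, 1653625174295],
    [0, -12016976818, 128134334332, 360806901951, 658996867620, 975216849361, 0, 0, 0,
     -434034771, 181122022543, 389672270892, 921485309310, 1653625174295, 2894099952001]],
   [[103233931368100, -2028475054450, -3759300897950, -2506918600940, -3094667838210,
     -21906006526560, 0, 0, 0, -1176880290300, -1136452018910, -1249191928270, 644901543520,
     8251279121410, 23114150398430],
    [-2028475054450, 135187158541, 139852086623, 20194960394, 45846781167, 772356316476, 0, 0,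
     0, 16954122906, -27489435037, -42869447069, -115918278778, -305492870179, -322927838213],
    [-3759300897950, 139852086623, 429040657650, 331195664467, 973173854316, 3370652329182, 0,
     0, 0, 40941467232, 2010048699, 24933407887, -107067538494, -444613463728, -1591697395945],
    [-2506918600940, 20194960394, 331195664467, 842214639941, 2231056106861, 5184014042836, 0,
     0, 0, 60671616738, 66394103970, 86331915480, -122336924654, -469596656353, -2325740802252],
    [-3094667838210, 45846781167, 973173854316, 2231056106861, 7441713526995, 17869126949972, 0,
     0, 0, 117870877632, -3376501947, 54689897779, -84285518631, 199188979837, -2940979202696],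
    [-21906006526560, 772356316476, 3370652329182, 5184014042836, 17869126949972,
     52762168703859, 0, 0, 0, 375635372777, -118792641476, 36716734069, -397967635188,
     -99698590583, -8130542639364],
    [0, 0, 0, 0, 0, 0, 0, 0, 0, 0, 0, 0, 0, 0, 0],
    [0, 0, 0, 0, 0, 0, 0, 0, 0, 0, 0, 0, 0, 0, 0],
    [0, 0, 0, 0, 0, 0, 0, 0, 0, 0, 0, 0, 0, 0, 0],
    [-1176880290300, 16954122906, 40941467232, 60671616738, 117870877632, 375635372777, 0, 0, 0,
     15442727342, 17340294302, 18837884536, -6879639632, -96437438323, -317015774991],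
    [-1136452018910, -27489435037, 2010048699, 66394103970, -3376501947, -118792641476, 0, 0, 0,
     17340294302, 48371013351, 57484104222, 17805424084, -130784650185, -583235084251],
    [-1249191928270, -42869447069, 24933407887, 86331915480, 54689897779, 36716734069, 0, 0, 0,
     18837884536, 57484104222, 74804183320, 38703017040, -112830896190, -716051610034],
    [644901543520, -115918278778, -107067538494, -122336924654, -84285518631, -397967635188, 0,
     0, 0, -6879639632, 17805424084, 38703017040, 209220194977, 556822330305, 886440405827],
    [8251279121410, -305492870179, -444613463728, -469596656353, 199188979837, -99698590583, 0,
     0, 0, -96437438323, -130784650185, -112830896190, 556822330305, 2319498351587,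
     5145415841355],
    [23114150398430, -322927838213, -1591697395945, -2325740802252, -2940979202696,
     -8130542639364, 0, 0, 0, -317015774991, -583235084251, -716051610034, 886440405827,
     5145415841355, 16346385274901]],
   [[0, 0, 0, 0, 0, 0, 0, 0, 0, 0, 0, 0, 0, 0, 0],
    [0, 72931600, -186231780, -51470580, -258249600, 1878569420, 0, 0, 0, -13817720, -1716540,
     -111455540, -321667640, -960229060, -1658228880],
    [0, -186231780, 710983585, 786021173, 2359957824, 4969428069, 0, 0, 0, -23069506, 281894791,
     752579813, 2352099902, 5333023433, 7562806004],
    [0, -51470580, 786021173, 1856763131, 4911440665, 25830149587, 0, 0, 0, -152569635,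
     772972444, 1380084402, 4483965431, 8689751960, 10426264445],
    [0, -258249600, 2359957824, 4911440665, 13200079718, 63894437531, 0, 0, 0, -372755450,
     2010981375, 3775546061, 12197859497, 24214176024, 29917246721],
    [0, 1878569420, 4969428069, 25830149587, 63894437531, 454299907924, 0, 0, 0, -2776889518,
     11468386075, 16543174647, 55216766028, 94793423583, 95377207165],
    [0, 0, 0, 0, 0, 0, 0, 0, 0, 0, 0, 0, 0, 0, 0],
    [0, 0, 0, 0, 0, 0, 0, 0, 0, 0, 0, 0, 0, 0, 0],
    [0, 0, 0, 0, 0, 0, 0, 0, 0, 0, 0, 0, 0, 0, 0],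
    [0, -13817720, -23069506, -152569635, -372755450, -2776889518, 0, 0, 0, 17096202, -68488263,
     -94923050, -318630535, -532450680, -511072277],
    [0, -1716540, 281894791, 772972444, 2010981375, 11468386075, 0, 0, 0, -68488263, 327225368,
     554354939, 1812276546, 3419272452, 3963059823],
    [0, -111455540, 752579813, 1380084402, 3775546061, 16543174647, 0, 0, 0, -94923050,
     554354939, 1100718875, 3534868663, 7195286388, 9151290661],
    [0, -321667640, 2352099902, 4483965431, 12197859497, 55216766028, 0, 0, 0, -318630535,
     1812276546, 3534868663, 11373294237, 22970791259, 28958158985],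
    [0, -960229060, 5333023433, 8689751960, 24214176024, 94793423583, 0, 0, 0, -532450680,
     3419272452, 7195286388, 22970791259, 47906787766, 62570967658],
    [0, -1658228880, 7562806004, 10426264445, 29917246721, 95377207165, 0, 0, 0, -511072277,
     3963059823, 9151290661, 28958158985, 62570967658, 94400430652]],
   [[6414219782161, 22859527406, 109148798207, 646383149082, 878030243497, 454242565636, 0, 0,
     0, -32283447357, -10133056631, 22385925409, 201496122360, 431532463459, 63558907576, 0, 0,
     -50842567325, -306531927823, -627302307128, -1184303842958, -1946557392921, -2612054308160,
     -2867768994968],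
    [22859527406, 10194989032, 1596690616, -2301987330, 2987901632, -149648185606, 0, 0, 0,
     -1641545736, -662337508, -1970759926, -3882182544, 9839051018, -35569347808, 0, 0,
     -10708445830, -6168211010, 1457051066, 11319341648, 16402256046, 27291638642, 72638951852],
    [109148798207, 1596690616, 31595200274, 30734524065, 125532280014, 106284581403, 0, 0, 0,
     -1772411470, -3389302560, 5544287137, 32867550612, 91807672069, 117668398720, 0, 0,
     6874273921, 2364363043, -19569438797, -54584988560, -89310500381, -90208389849,
     -99445286178],
    [646383149082, -2301987330, 30734524065, 110843777626, 202657421099, 103404128311, 0, 0, 0,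
     7852645, 1832225533, 11823870208, 65649602844, 146028350435, 314278843293, 0, 0,
     -1897727404, -51035823207, -105759706576, -198661544143, -297922728883, -371202877228,
     -388748515040],
    [878030243497, 2987901632, 125532280014, 202657421099, 798516584395, 1342262083692, 0, 0, 0,
     -4541451762, -6456054453, 37642171437, 219290652313, 533763979623, 869133674282, 0, 0,
     9901548076, -52904577502, -177884950436, -409399006199, -600808015429, -630284298232,
     -621222394649],
    [454242565636, -149648185606, 106284581403, 103404128311, 1342262083692, 7494436677007, 0,
     0, 0, 7561522777, -8915109815, 78124169544, 370687608611, 562359935196, 1276177299934, 0,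
     0, 149014551191, 99750109703, -114156503887, -548873251579, -745603211880, -761162014597,
     -1403179060941],
    [0, 0, 0, 0, 0, 0, 0, 0, 0, 0, 0, 0, 0, 0, 0, 0, 0, 0, 0, 0, 0, 0, 0, 0],
    [0, 0, 0, 0, 0, 0, 0, 0, 0, 0, 0, 0, 0, 0, 0, 0, 0, 0, 0, 0, 0, 0, 0, 0],
    [0, 0, 0, 0, 0, 0, 0, 0, 0, 0, 0, 0, 0, 0, 0, 0, 0, 0, 0, 0, 0, 0, 0, 0],
    [-32283447357, -1641545736, -1772411470, 7852645, -4541451762, 7561522777, 0, 0, 0,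
     856510163, 905368666, 612192197, 1309223782, -502099441, 28960393320, 0, 0, 54023401,
     -2000715418, -1371157800, -431002068, 3486635058, 3984083886, 3700300018],
    [-10133056631, -662337508, -3389302560, 1832225533, -6456054453, -8915109815, 0, 0, 0,
     905368666, 1402356481, 482847675, 1113304018, -650574682, 33757606193, 0, 0, -2758612696,
     -6439876604, -4817087898, -3319356995, 974011248, -159077156, 6612623257],
    [22385925409, -1970759926, 5544287137, 11823870208, 37642171437, 78124169544, 0, 0, 0,
     612192197, 482847675, 2693962481, 13105028788, 27728576757, 76048858470, 0, 0, 1270338231,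
     -4563927781, -11478793206, -23893613510, -31718754187, -34498030062, -37897493304],
    [201496122360, -3882182544, 32867550612, 65649602844, 219290652313, 370687608611, 0, 0, 0,
     1309223782, 1113304018, 13105028788, 69209872007, 158106411806, 357221836876, 0, 0,
     1886285510, -25988384202, -62503493847, -129921958058, -178661943134, -191764133767,
     -189973626033],
    [431532463459, 9839051018, 91807672069, 146028350435, 533763979623, 562359935196, 0, 0, 0,
     -502099441, -650574682, 27728576757, 158106411806, 405242439805, 780774600193, 0, 0,
     -9240187992, -60254969666, -133709505104, -272956497193, -377750540021, -377628329547,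
     -297670350538],
    [63558907576, -35569347808, 117668398720, 314278843293, 869133674282, 1276177299934, 0, 0,
     0, 28960393320, 33757606193, 76048858470, 357221836876, 780774600193, 2720158091839, 0, 0,
     -39035115199, -231329140780, -351885729085, -597641601414, -677092598035, -695133187261,
     -530837582828],
    [0, 0, 0, 0, 0, 0, 0, 0, 0, 0, 0, 0, 0, 0, 0, 0, 0, 0, 0, 0, 0, 0, 0, 0],
    [0, 0, 0, 0, 0, 0, 0, 0, 0, 0, 0, 0, 0, 0, 0, 0, 0, 0, 0, 0, 0, 0, 0, 0],
    [-50842567325, -10708445830, 6874273921, -1897727404, 9901548076, 149014551191, 0, 0, 0,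
     54023401, -2758612696, 1270338231, 1886285510, -9240187992, -39035115199, 0, 0,
     22664628354, 26993564173, 12875591925, -1817677956, -18297279713, -26001929382,
     -96962809965],
    [-306531927823, -6168211010, 2364363043, -51035823207, -52904577502, 99750109703, 0, 0, 0,
     -2000715418, -6439876604, -4563927781, -25988384202, -60254969666, -231329140780, 0, 0,
     26993564173, 59805334483, 66077622069, 87794268979, 104923470936, 134098765961, 68698521486],
    [-627302307128, 1457051066, -19569438797, -105759706576, -177884950436, -114156503887, 0, 0,
     0, -1371157800, -4817087898, -11478793206, -62503493847, -133709505104, -351885729085, 0,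
     0, 12875591925, 66077622069, 110647143429, 192535762634, 274013018723, 344336111337,
     336060305748],
    [-1184303842958, 11319341648, -54584988560, -198661544143, -409399006199, -548873251579, 0,
     0, 0, -431002068, -3319356995, -23893613510, -129921958058, -272956497193, -597641601414,
     0, 0, -1817677956, 87794268979, 192535762634, 375002037348, 557689979558, 690701360463,
     751552043113],
    [-1946557392921, 16402256046, -89310500381, -297922728883, -600808015429, -745603211880, 0,
     0, 0, 3486635058, 974011248, -31718754187, -178661943134, -377750540021, -677092598035, 0,
     0, -18297279713, 104923470936, 274013018723, 557689979558, 865672821272, 1085308664032,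
     1230908007881],
    [-2612054308160, 27291638642, -90208389849, -371202877228, -630284298232, -761162014597, 0,
     0, 0, 3984083886, -159077156, -34498030062, -191764133767, -377628329547, -695133187261, 0,
     0, -26001929382, 134098765961, 344336111337, 690701360463, 1085308664032, 1405303274567,
     1634743512038],
    [-2867768994968, 72638951852, -99445286178, -388748515040, -621222394649, -1403179060941, 0,
     0, 0, 3700300018, 6612623257, -37897493304, -189973626033, -297670350538, -530837582828, 0,
     0, -96962809965, 68698521486, 336060305748, 751552043113, 1230908007881, 1634743512038,
     2162685006171]],
   [[0, 0, 0, 0, 0, 0, 0, 0, 0, 0, 0, 0, 0, 0, 0, 0, 0, 0, 0, 0, 0, 0, 0],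
    [0, 2669956, 2434660, -12755004, -47018350, 0, 0, 0, 0, 2709172, -3851338, -13294224,
     -45211146, -79783318, 0, 0, 0, 2754924, -17555696, -13495206, -45547750, -85673888,
     -108661000],
    [0, 2434660, 2223821, -11631367, -42875543, 0, 0, 0, 0, 2470359, -3512113, -12123067,
     -41228030, -72753328, 0, 0, 0, 2512018, -16010634, -12306398, -41535031, -78126669,
     -99089087],
    [0, -12755004, -11631367, 60938174, 224632883, 0, 0, 0, 0, -12942743, 18400304, 63514087,
     215997955, 381167004, 0, 0, 0, -13161639, 83873999, 64474031, 217605864, 409311335,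
     519133371],
    [0, -47018350, -42875543, 224632883, 828058594, 0, 0, 0, 0, -47710539, 67827830, 234128981,
     796223417, 1405079169, 0, 0, 0, -48517520, 309180018, 237667477, 802150628, 1508825855,
     1913657319],
    [0, 0, 0, 0, 0, 0, 0, 0, 0, 0, 0, 0, 0, 0, 0, 0, 0, 0, 0, 0, 0, 0, 0],
    [0, 0, 0, 0, 0, 0, 0, 0, 0, 0, 0, 0, 0, 0, 0, 0, 0, 0, 0, 0, 0, 0, 0],
    [0, 0, 0, 0, 0, 0, 0, 0, 0, 0, 0, 0, 0, 0, 0, 0, 0, 0, 0, 0, 0, 0, 0],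
    [0, 0, 0, 0, 0, 0, 0, 0, 0, 0, 0, 0, 0, 0, 0, 0, 0, 0, 0, 0, 0, 0, 0],
    [0, 2709172, 2470359, -12942743, -47710539, 0, 0, 0, 0, 2749059, -3907947, -13489877,
     -45876445, -80957275, 0, 0, 0, 2795569, -17814177, -13693744, -46217959, -86934684,
     -110259878],
    [0, -3851338, -3512113, 18400304, 67827830, 0, 0, 0, 0, -3907947, 5556382, 19178198,
     65220789, 115093937, 0, 0, 0, -3973947, 25325256, 19468138, 65706327, 123591937, 156753049],
    [0, -13294224, -12123067, 63514087, 234128981, 0, 0, 0, 0, -13489877, 19178198, 66199105,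
     225129118, 397280702, 0, 0, 0, -13717985, 87419642, 67199662, 226805040, 426614722,
     541079442],
    [0, -45211146, -41228030, 215997955, 796223417, 0, 0, 0, 0, -45876445, 65220789, 225129118,
     765617012, 1351068713, 0, 0, 0, -46652140, 297295596, 228531861, 771316523, 1450826951,
     1840097104],
    [0, -79783318, -72753328, 381167004, 1405079169, 0, 0, 0, 0, -80957275, 115093937,
     397280702, 1351068713, 2384494461, 0, 0, 0, -82326045, 524629946, 403285519, 1361126562,
     2560238934, 3247178127],
    [0, 0, 0, 0, 0, 0, 0, 0, 0, 0, 0, 0, 0, 0, 0, 0, 0, 0, 0, 0, 0, 0, 0],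
    [0, 0, 0, 0, 0, 0, 0, 0, 0, 0, 0, 0, 0, 0, 0, 0, 0, 0, 0, 0, 0, 0, 0],
    [0, 0, 0, 0, 0, 0, 0, 0, 0, 0, 0, 0, 0, 0, 0, 0, 0, 0, 0, 0, 0, 0, 0],
    [0, 2754924, 2512018, -13161639, -48517520, 0, 0, 0, 0, 2795569, -3973947, -13717985,
     -46652140, -82326045, 0, 0, 0, 2842961, -18115521, -13925225, -46999383, -88404689,
     -112124326],
    [0, -17555696, -16010634, 83873999, 309180018, 0, 0, 0, 0, -17814177, 25325256, 87419642,
     297295596, 524629946, 0, 0, 0, -18115521, 115447088, 88740862, 299508778, 563369108,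
     714525819],
    [0, -13495206, -12306398, 64474031, 237667477, 0, 0, 0, 0, -13693744, 19468138, 67199662,
     228531861, 403285519, 0, 0, 0, -13925225, 88740862, 68215447, 230233195, 433062844,
     549257768],
    [0, -45547750, -41535031, 217605864, 802150628, 0, 0, 0, 0, -46217959, 65706327, 226805040,
     771316523, 1361126562, 0, 0, 0, -46999383, 299508778, 230233195, 777058565, 1461627448,
     1853795538],
    [0, -85673888, -78126669, 409311335, 1508825855, 0, 0, 0, 0, -86934684, 123591937,
     426614722, 1450826951, 2560238934, 0, 0, 0, -88404689, 563369108, 433062844, 1461627448,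
     2749337547, 3486944501],
    [0, -108661000, -99089087, 519133371, 1913657319, 0, 0, 0, 0, -110259878, 156753049,
     541079442, 1840097104, 3247178127, 0, 0, 0, -112124326, 714525819, 549257768, 1853795538,
     3486944501, 4509036047]]]

/-- The entry of a list of lists at a given position, with the value `0` outside. -/
def tableEntry (T : List (List ℤ)) (r s : ℕ) : ℤ := (T.getD r []).getD s 0

/-- Entry `(r, s)` of the certificate matrix of subsets of size `a` and degree `k`. -/
def gram (a k r s : ℕ) : ℤ := tableEntry (gramTables.getD (2 * a + k) []) r s

/-- The row of the certificate matrices that belongs to a difference of weight `D` meeting the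
chosen subset in `p` points. -/
def rowIndex (p D : ℕ) : ℕ := 4 * p + (D / 2 - 4)

/-- The certificate kernel at two differences of weights `D`, `E` that meet the chosen subset of
size `a` in `p` and `q` points and have `t` common points outside of it. -/
def kernel (a p D q E : ℕ) (t : ℤ) : ℤ :=
  gram a 0 (rowIndex p D) (rowIndex q E) +
    gram a 1 (rowIndex p D) (rowIndex q E) * ((22 - a) * t - (D - p) * (E - q))

/-- `s!` times the elementary symmetric polynomial of degree `s ≤ 4` of `N` signs with sum `e`. -/
def signSymm : ℕ → ℤ → ℤ → ℤ
  | 0, _, _ => 1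
  | 1, _, e => e
  | 2, N, e => e * e - N
  | 3, N, e => e * (e * e - 3 * N + 2)
  | _, N, e => e * e * (e * e - 6 * N + 8) + 3 * N * (N - 2)

/-- The tuples `(s₀, s₁, s₂, s₃)` of sum at most four with `s₁`, `s₂`, `s₃` of equal parity, each
with its multinomial coefficient. -/
def splitTerms : List (ℕ × ℕ × ℕ × ℕ × ℕ) :=
  [(1, 0, 0, 0, 0), (1, 1, 0, 0, 0), (1, 0, 0, 0, 2), (1, 0, 0, 2, 0), (1, 0, 2, 0, 0),
   (1, 2, 0, 0, 0), (6, 0, 1, 1, 1), (3, 1, 0, 0, 2), (3, 1, 0, 2, 0), (3, 1, 2, 0, 0),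
   (1, 3, 0, 0, 0), (1, 0, 0, 0, 4), (6, 0, 0, 2, 2), (1, 0, 0, 4, 0), (6, 0, 2, 0, 2),
   (6, 0, 2, 2, 0), (1, 0, 4, 0, 0), (24, 1, 1, 1, 1), (6, 2, 0, 0, 2), (6, 2, 0, 2, 0),
   (6, 2, 2, 0, 0), (1, 4, 0, 0, 0)]

/-- The certificate kernel, summed over subsets, in terms of the sizes `N` and the sign sums `e` of
the four groups of coordinates. -/
def groupSum (N₀ N₁ N₂ N₃ : ℕ) (e₀ e₁ e₂ e₃ : ℤ) : ℤ :=
  (splitTerms.map fun (m, s₀, s₁, s₂, s₃) =>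
    m * kernel (s₀ + s₁ + s₂ + s₃) (s₁ + s₃) (N₁ + N₃) (s₂ + s₃) (N₂ + N₃) (N₃ - s₃) *
      (signSymm s₀ N₀ e₀ * signSymm s₁ N₁ e₁ * (signSymm s₂ N₂ e₂ * signSymm s₃ N₃ e₃))).sum

/-- The symmetrized kernel in terms of the numbers of coordinates where four words show a given
pattern. -/
def countSum (n a b c d p q r : ℕ) : ℤ :=
  groupSum (n + p) (a + b) (c + d) (q + r) (n - p) (b - a) (d - c) (q - r) +
  groupSum (n + q) (a + c) (b + d) (p + r) (n - q) (c - a) (d - b) (p - r) +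
  groupSum (n + r) (a + d) (b + c) (p + q) (n - r) (d - a) (c - b) (p - q)

/-- Whether `D` is a distance of an even code of length 22 and minimum distance ten. -/
def isDist (D : ℕ) : Bool := D == 0 || (10 ≤ D && D % 2 == 0)

/-- The pointwise inequality of the certificate for all quadruples of words with at most one
coincidence, up to reordering. -/
def checkCounts (d : ℕ) : Bool :=
  (List.range (d + 1)).all fun c => (List.range (c + 1)).all fun b =>
  (List.range (b + 1)).all fun a =>
    !(Nat.ble (a + b + c + d) 22 && (a + b + c + d) % 2 == 0) ||
  (List.range (23 - (a + b + c + d))).all fun q =>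
  (List.range (23 - (a + b + c + d + q))).all fun r =>
    !(isDist (a + b + (q + r)) && isDist (c + d + (q + r))) ||
  (List.range (23 - (a + b + c + d + q + r))).all fun p =>
    !(isDist (a + c + (p + r)) && isDist (b + d + (p + r)) && isDist (a + d + (p + q)) &&
      isDist (b + c + (p + q)) &&
      Nat.ble ([a + b + (q + r), c + d + (q + r), a + c + (p + r), b + d + (p + r),
        a + d + (p + q), b + c + (p + q)].count 0) 1) ||
    decide (countSum (22 - (a + b + c + d + p + q + r)) a b c d p q r ≤ 0)

open Finset

theorem gramTables_eq : gramTables = factorTables.map fun F =>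
    F.map fun u => F.map fun v => (List.zipWith (· * ·) u v).sum := by
  decide +kernel

theorem length_le_of_mem_factorTables :
    ∀ F ∈ factorTables, ∀ u ∈ F, u.length ≤ 24 := by
  decide +kernel

/-- Entry `(r, l)` of the factor of a certificate matrix. -/
def factor (a k r l : ℕ) : ℤ := tableEntry (factorTables.getD (2 * a + k) []) r l

theorem sum_zipWith_mul (n : ℕ) (u v : List ℤ) (hu : u.length ≤ n) :
    (List.zipWith (· * ·) u v).sum = ∑ l ∈ range n, u.getD l 0 * v.getD l 0 := by
  induction n generalizing u v with
  | zero => simp [List.length_eq_zero_iff.mp (Nat.le_zero.mp hu)]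
  | succ n ih =>
    rw [sum_range_succ']
    rcases u with _ | ⟨x, u⟩
    · simp
    rcases v with _ | ⟨y, v⟩
    · simp
    have := ih u v (by simpa using hu)
    simp [this, add_comm]

theorem gram_eq_sum (a k r s : ℕ) :
    gram a k r s = ∑ l ∈ range 24, factor a k r l * factor a k s l := by
  simp only [gram, factor, tableEntry]
  have hmap : gramTables.getD (2 * a + k) [] = (factorTables.getD (2 * a + k) []).map fun u =>
      (factorTables.getD (2 * a + k) []).map fun v => (List.zipWith (· * ·) u v).sum := by
    rw [gramTables_eq]
    exact List.getD_map _ [] (fun F : List (List ℤ) =>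
      F.map fun u => F.map fun v => (List.zipWith (· * ·) u v).sum)
  have hF : ∀ u ∈ factorTables.getD (2 * a + k) [], u.length ≤ 24 := by
    rcases lt_or_ge (2 * a + k) factorTables.length with h | h
    · rw [List.getD_eq_getElem _ _ h]
      exact length_le_of_mem_factorTables _ (List.getElem_mem h)
    · simp [h]
  rw [hmap]
  generalize factorTables.getD (2 * a + k) [] = F at hF
  rcases lt_or_ge r F.length with hr | hr
  · have hr' : (F.map fun u => F.map fun v => (List.zipWith (· * ·) u v).sum).getD r [] =
        F.map fun v => (List.zipWith (· * ·) (F.getD r []) v).sum := by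
      simp [hr]
    have hs' : (F.map fun v => (List.zipWith (· * ·) (F.getD r []) v).sum).getD s 0 =
        (List.zipWith (· * ·) (F.getD r []) (F.getD s [])).sum := by
      rcases lt_or_ge s F.length with hs | hs <;> simp [hs]
    rw [hr', hs', sum_zipWith_mul 24 _ _ (by simpa [hr] using hF _ (List.getElem_mem hr))]
  · simp [hr]

theorem gram_comm (a k r s : ℕ) : gram a k r s = gram a k s r := by
  simp only [gram_eq_sum, mul_comm]

theorem kernel_comm (a p D q E : ℕ) (t : ℤ) : kernel a p D q E t = kernel a q E p D t := by
  simp only [kernel, gram_comm a _ (rowIndex p D), mul_comm ((D : ℤ) - p)]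

/-- The set of coordinates where two words differ. -/
def diff (w x : Fin 22 → Bool) : Finset (Fin 22) := {i | w i ≠ x i}

/-- The sign of a bit. -/
def bitSign (b : Bool) : ℤ := if b then -1 else 1

/-- The character of `U` at a word. -/
def character (U : Finset (Fin 22)) (w : Fin 22 → Bool) : ℤ := ∏ i ∈ U, bitSign (w i)

/-- The contribution of the subset `U` to the kernel at a quadruple of words. -/
def subsetTerm (U : Finset (Fin 22)) (w x y z : Fin 22 → Bool) : ℤ :=
  if #U < 5 ∧ Even #(U ∩ diff w x) ∧ Even #(U ∩ diff y z) then
    (#U).factorial * (character U w * character U y) *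
      kernel #U #(U ∩ diff w x) #(diff w x) #(U ∩ diff y z) #(diff y z)
        #((diff w x ∩ diff y z) \ U)
  else 0

/-- The positive semidefinite kernel at a quadruple of words. -/
def quadSum (w x y z : Fin 22 → Bool) : ℤ := ∑ U, subsetTerm U w x y z

/-- The `l`-th feature of a pair of words that belongs to the subset `U` and degree `k`. -/
def feature (U : Finset (Fin 22)) (k l : ℕ) (u : (Fin 22 → Bool) × (Fin 22 → Bool)) : ℤ :=
  if Even #(U ∩ diff u.1 u.2) then
    character U u.1 * factor #U k (rowIndex #(U ∩ diff u.1 u.2) #(diff u.1 u.2)) l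
  else 0

/-- The `l`-th feature of degree one, localized at a coordinate `i` outside of `U`. -/
def localFeature (U : Finset (Fin 22)) (i : Fin 22) (l : ℕ)
    (u : (Fin 22 → Bool) × (Fin 22 → Bool)) : ℤ :=
  feature U 1 l u * ((22 - #U) * (if i ∈ diff u.1 u.2 then 1 else 0) -
    (#(diff u.1 u.2) - #(U ∩ diff u.1 u.2)))

theorem sum_compl_centered_mul (U d e : Finset (Fin 22)) :
    ∑ i ∈ Uᶜ, (((22 - #U : ℤ) * (if i ∈ d then 1 else 0) - (#d - #(U ∩ d))) *
        ((22 - #U) * (if i ∈ e then 1 else 0) - (#e - #(U ∩ e)))) =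
      (22 - #U) * ((22 - #U) * #((d ∩ e) \ U) - (#d - #(U ∩ d)) * (#e - #(U ∩ e))) := by
  have hcard : (#Uᶜ : ℤ) = 22 - #U := by
    have := card_compl_add_card U
    simp only [Fintype.card_fin] at this
    lia
  have hsum (d : Finset (Fin 22)) : ∑ i ∈ Uᶜ, (if i ∈ d then 1 else 0 : ℤ) = #d - #(U ∩ d) := by
    have h1 := card_sdiff_add_card_inter d U
    have h2 : d \ U = {i ∈ Uᶜ | i ∈ d} := by ext; simp [and_comm]
    rw [inter_comm, sum_boole, ← h2]
    lia
  have hinter : ∑ i ∈ Uᶜ, ((if i ∈ d then 1 else 0) * (if i ∈ e then 1 else 0) : ℤ) =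
      #((d ∩ e) \ U) := by
    have h2 : (d ∩ e) \ U = {i ∈ Uᶜ | i ∈ d ∩ e} := by ext; simp [and_comm]
    rw [h2, ← sum_boole]
    refine sum_congr rfl fun i _ => ?_
    by_cases hd : i ∈ d <;> simp [hd]
  have hexp (m q r x y : ℤ) : (m * x - q) * (m * y - r) =
      m * m * (x * y) - m * r * x - m * q * y + q * r := by ring
  simp only [hexp, sum_add_distrib, sum_sub_distrib, ← mul_sum, hinter, hsum, sum_const,
    nsmul_eq_mul, hcard]
  ring

theorem sum_localFeature_mul (U : Finset (Fin 22)) (u v : (Fin 22 → Bool) × (Fin 22 → Bool)) :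
    ∑ l ∈ range 24, ∑ i ∈ Uᶜ, localFeature U i l u * localFeature U i l v =
      (∑ l ∈ range 24, feature U 1 l u * feature U 1 l v) * ((22 - #U) *
        ((22 - #U) * #((diff u.1 u.2 ∩ diff v.1 v.2) \ U) -
          (#(diff u.1 u.2) - #(U ∩ diff u.1 u.2)) * (#(diff v.1 v.2) - #(U ∩ diff v.1 v.2)))) := by
  rw [sum_mul]
  refine sum_congr rfl fun l _ => ?_
  rw [← sum_compl_centered_mul, mul_sum]
  refine sum_congr rfl fun i _ => ?_
  simp only [localFeature]
  ring

theorem sum_feature_mul (U : Finset (Fin 22)) (k : ℕ)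
    (u v : (Fin 22 → Bool) × (Fin 22 → Bool)) :
    ∑ l ∈ range 24, feature U k l u * feature U k l v =
      if Even #(U ∩ diff u.1 u.2) ∧ Even #(U ∩ diff v.1 v.2) then
        character U u.1 * character U v.1 *
          gram #U k (rowIndex #(U ∩ diff u.1 u.2) #(diff u.1 u.2))
            (rowIndex #(U ∩ diff v.1 v.2) #(diff v.1 v.2))
      else 0 := by
  by_cases hu : Even #(U ∩ diff u.1 u.2)
  swap
  · simp [feature, hu]
  by_cases hv : Even #(U ∩ diff v.1 v.2)
  swap
  · simp [feature, hv]
  simp only [feature, hu, hv, and_self, if_true, gram_eq_sum, mul_sum]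
  exact sum_congr rfl fun l _ => by ring

theorem mul_subsetTerm {U : Finset (Fin 22)} (hU : #U < 5)
    (u v : (Fin 22 → Bool) × (Fin 22 → Bool)) :
    (22 - #U) * subsetTerm U u.1 u.2 v.1 v.2 =
      (#U).factorial * ((22 - #U) * ∑ l ∈ range 24, feature U 0 l u * feature U 0 l v +
        ∑ l ∈ range 24, ∑ i ∈ Uᶜ, localFeature U i l u * localFeature U i l v) := by
  rw [sum_localFeature_mul, sum_feature_mul, sum_feature_mul]
  simp only [subsetTerm, kernel, hU, true_and]
  split_ifs <;> ring

theorem sum_sum_sum_mul_nonneg {α β : Type*} (S : Finset α) (T : Finset β) (f : β → α → ℤ) :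
    0 ≤ ∑ u ∈ S, ∑ v ∈ S, ∑ l ∈ T, f l u * f l v := by
  calc (0 : ℤ) ≤ ∑ l ∈ T, (∑ u ∈ S, f l u) ^ 2 := by positivity
    _ = ∑ u ∈ S, ∑ v ∈ S, ∑ l ∈ T, f l u * f l v := by
      simp only [sq, sum_mul_sum]
      rw [sum_comm]
      exact sum_congr rfl fun u _ => sum_comm

theorem sum_subsetTerm_nonneg (Q : Finset ((Fin 22 → Bool) × (Fin 22 → Bool)))
    (U : Finset (Fin 22)) : 0 ≤ ∑ u ∈ Q, ∑ v ∈ Q, subsetTerm U u.1 u.2 v.1 v.2 := by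
  by_cases hU : #U < 5
  swap
  · simp [subsetTerm, hU]
  have h0 := sum_sum_sum_mul_nonneg Q (range 24) (feature U 0)
  have h1 := sum_sum_sum_mul_nonneg Q (range 24 ×ˢ Uᶜ) fun p => localFeature U p.2 p.1
  simp only [sum_product] at h1
  have hpos : (0 : ℤ) < 22 - #U := by lia
  refine nonneg_of_mul_nonneg_right ?_ hpos
  simp only [mul_sum, mul_subsetTerm hU]
  simp only [← mul_sum, sum_add_distrib]
  positivity

/-- The square for the empty set and degree zero, completed by a constant feature. -/
theorem sum_subsetTerm_empty (Q : Finset ((Fin 22 → Bool) × (Fin 22 → Bool))) :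
    0 ≤ gram 0 0 8 8 + 2 * ∑ u ∈ Q, gram 0 0 8 (rowIndex 0 #(diff u.1 u.2)) +
      ∑ u ∈ Q, ∑ v ∈ Q, subsetTerm ∅ u.1 u.2 v.1 v.2 := by
  have h0 := sum_sum_sum_mul_nonneg (insertNone Q) (range 24)
    fun l u => u.elim (factor 0 0 8 l) (feature ∅ 0 l)
  have h1 := sum_sum_sum_mul_nonneg Q (range 24 ×ˢ univ) fun p => localFeature ∅ p.2 p.1
  simp only [sum_product] at h1
  simp only [sum_insertNone, Option.elim, ← gram_eq_sum, sum_add_distrib] at h0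
  have hf (u) : ∑ l ∈ range 24, factor 0 0 8 l * feature ∅ 0 l u =
      gram 0 0 8 (rowIndex 0 #(diff u.1 u.2)) := by
    simp [feature, character, gram_eq_sum]
  have hf' (u) : ∑ l ∈ range 24, feature ∅ 0 l u * factor 0 0 8 l =
      gram 0 0 8 (rowIndex 0 #(diff u.1 u.2)) := by
    rw [← hf]
    exact sum_congr rfl fun l _ => mul_comm _ _
  simp only [hf, hf'] at h0
  have hterm := fun u v => mul_subsetTerm (U := ∅) (by simp) u v
  simp only [card_empty, Nat.cast_zero, sub_zero, Nat.factorial_zero, Nat.cast_one, one_mul,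
    compl_empty] at hterm
  have h2 : 22 * ∑ u ∈ Q, ∑ v ∈ Q, subsetTerm ∅ u.1 u.2 v.1 v.2 =
      22 * ∑ u ∈ Q, ∑ v ∈ Q, ∑ l ∈ range 24, feature ∅ 0 l u * feature ∅ 0 l v +
      ∑ u ∈ Q, ∑ v ∈ Q, ∑ l ∈ range 24, ∑ i, localFeature ∅ i l u * localFeature ∅ i l v := by
    rw [mul_sum, mul_sum, ← sum_add_distrib]
    refine sum_congr rfl fun u _ => ?_
    rw [mul_sum, mul_sum, ← sum_add_distrib]
    exact sum_congr rfl fun v _ => hterm u v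
  lia

theorem sum_quadSum_nonneg (Q : Finset ((Fin 22 → Bool) × (Fin 22 → Bool))) :
    0 ≤ gram 0 0 8 8 + 2 * ∑ u ∈ Q, gram 0 0 8 (rowIndex 0 #(diff u.1 u.2)) +
      ∑ u ∈ Q, ∑ v ∈ Q, quadSum u.1 u.2 v.1 v.2 := by
  have h : ∑ u ∈ Q, ∑ v ∈ Q, quadSum u.1 u.2 v.1 v.2 =
      ∑ U, ∑ u ∈ Q, ∑ v ∈ Q, subsetTerm U u.1 u.2 v.1 v.2 := by
    simp only [quadSum]
    symm
    rw [sum_comm]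
    exact sum_congr rfl fun u _ => sum_comm
  rw [h, ← add_sum_erase univ _ (mem_univ ∅)]
  have := sum_subsetTerm_empty Q
  have := sum_nonneg (s := univ.erase ∅) fun U _ => sum_subsetTerm_nonneg Q U
  lia

theorem sum_powerset_union {ι M : Type*} [DecidableEq ι] [AddCommMonoid M] {A B : Finset ι}
    (h : Disjoint A B) (f : Finset ι → M) :
    ∑ U ∈ (A ∪ B).powerset, f U = ∑ U ∈ A.powerset, ∑ V ∈ B.powerset, f (U ∪ V) := by
  induction B using Finset.induction_on generalizing f with
  | empty => simp
  | insert i B hi ih =>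
    rw [disjoint_insert_right] at h
    have hi' : i ∉ A ∪ B := by simp [h.1, hi]
    rw [union_insert, sum_powerset_insert hi', ih h.2, ih h.2, ← sum_add_distrib]
    refine sum_congr rfl fun U _ => ?_
    rw [sum_powerset_insert hi]
    simp [union_insert]

/-- The elementary symmetric polynomial of degree `s` of `ε` on `G`. -/
def elemSymm {ι : Type*} (ε : ι → ℤ) (G : Finset ι) (s : ℕ) : ℤ :=
  ∑ U ∈ G.powersetCard s, ∏ i ∈ U, ε i

theorem elemSymm_insert {ι : Type*} [DecidableEq ι] (ε : ι → ℤ) {G : Finset ι} {i : ι}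
    (hi : i ∉ G) (s : ℕ) :
    elemSymm ε (insert i G) (s + 1) = elemSymm ε G (s + 1) + ε i * elemSymm ε G s := by
  have hU : ∀ U ∈ G.powersetCard s, i ∉ U := fun U hU hiU =>
    hi ((mem_powersetCard.mp hU).1 hiU)
  rw [elemSymm, powersetCard_succ_insert hi, sum_union, sum_image, elemSymm, elemSymm, mul_sum]
  · congr 1
    exact sum_congr rfl fun U h => prod_insert (hU U h)
  · intro U hU' V hV' h
    rw [← erase_insert (hU U hU'), ← erase_insert (hU V hV'), h]
  · refine disjoint_left.mpr fun U h h' => ?_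
    obtain ⟨V, _, rfl⟩ := mem_image.mp h'
    exact hi ((mem_powersetCard.mp h).1 (mem_insert_self i V))

theorem factorial_mul_elemSymm {ι : Type*} [DecidableEq ι] {ε : ι → ℤ} (hε : ∀ i, ε i * ε i = 1)
    (G : Finset ι) {s : ℕ} (hs : s < 5) :
    s.factorial * elemSymm ε G s = signSymm s #G (∑ i ∈ G, ε i) := by
  induction G using Finset.induction_on generalizing s with
  | empty =>
    rcases s with _ | s
    · simp [elemSymm, signSymm]
    · have : elemSymm ε ∅ (s + 1) = 0 := by
        rw [elemSymm, powersetCard_eq_empty.mpr (by simp), sum_empty]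
      rw [this]
      have : s < 4 := by lia
      interval_cases s <;> simp [signSymm]
  | insert i G hi ih =>
    rcases s with _ | s
    · simp [elemSymm, signSymm]
    have h1 := ih hs
    have h2 := ih (Nat.lt_of_succ_lt hs)
    rw [elemSymm_insert ε hi, sum_insert hi, card_insert_of_notMem hi, mul_add, h1]
    have h3 : ((s + 1).factorial : ℤ) * (ε i * elemSymm ε G s) =
        (s + 1) * ε i * (s.factorial * elemSymm ε G s) := by
      push_cast [Nat.factorial_succ]
      ring
    rw [h3, h2]
    have hε' := hε i
    generalize ε i = x at *
    generalize ∑ i ∈ G, ε i = e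
    generalize #G = N
    obtain rfl | rfl : x = 1 ∨ x = -1 := by
      rcases Int.eq_one_or_neg_one_of_mul_eq_one hε' with h | h <;> simp [h]
    all_goals
      have : s < 4 := by lia
      interval_cases s <;> simp only [signSymm] <;> push_cast <;> ring

theorem sum_powerset_prod_mul {ι : Type*} (ε : ι → ℤ) (G : Finset ι) {φ : ℕ → ℤ}
    (hφ : ∀ s, 5 ≤ s → φ s = 0) :
    ∑ U ∈ G.powerset, (∏ i ∈ U, ε i) * φ #U = ∑ s ∈ range 5, elemSymm ε G s * φ s := by
  have h (n : ℕ) (hn : 5 ≤ n) : ∑ s ∈ range n, elemSymm ε G s * φ s =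
      ∑ s ∈ range 5, elemSymm ε G s * φ s := by
    refine (sum_subset (range_subset_range.mpr hn) fun s _ hs => ?_).symm
    rw [hφ s (by simpa using hs), mul_zero]
  rw [← h (#G + 5) (by lia), sum_powerset]
  rw [sum_subset (range_subset_range.mpr (show #G + 1 ≤ #G + 5 by lia))]
  · refine sum_congr rfl fun s _ => ?_
    rw [elemSymm, sum_mul]
    exact sum_congr rfl fun U hU => by rw [(mem_powersetCard.mp hU).2]
  · intro s _ hs
    rw [powersetCard_eq_empty.mpr (by simpa [Nat.lt_succ_iff] using hs), sum_empty]

theorem sum_powerset_four {ι : Type*} (ε : ι → ℤ) (A B C D : Finset ι) (W : ℕ → ℕ → ℕ → ℕ → ℤ)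
    (hW : ∀ a b c d, 5 ≤ a + b + c + d → W a b c d = 0) :
    ∑ S ∈ A.powerset, ∑ T ∈ B.powerset, ∑ U ∈ C.powerset, ∑ V ∈ D.powerset,
      (∏ i ∈ S, ε i) * ((∏ i ∈ T, ε i) * ((∏ i ∈ U, ε i) * ((∏ i ∈ V, ε i) * W #S #T #U #V))) =
    ∑ a ∈ range 5, ∑ b ∈ range 5, ∑ c ∈ range 5, ∑ d ∈ range 5,
      elemSymm ε A a * (elemSymm ε B b * (elemSymm ε C c * (elemSymm ε D d * W a b c d))) := by
  have hD (a b c) := sum_powerset_prod_mul ε D (φ := W a b c) fun d hd => hW a b c d (by lia)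
  have hC (a b) := sum_powerset_prod_mul ε C
    (φ := fun c => ∑ d ∈ range 5, elemSymm ε D d * W a b c d)
    fun c hc => sum_eq_zero fun d _ => by rw [hW a b c d (by lia), mul_zero]
  have hB (a) := sum_powerset_prod_mul ε B
    (φ := fun b => ∑ c ∈ range 5, elemSymm ε C c * ∑ d ∈ range 5, elemSymm ε D d * W a b c d)
    fun b hb => sum_eq_zero fun c _ => by
      rw [sum_eq_zero fun d _ => by rw [hW a b c d (by lia), mul_zero], mul_zero]
  have hA := sum_powerset_prod_mul ε A
    (φ := fun a => ∑ b ∈ range 5, elemSymm ε B b * ∑ c ∈ range 5, elemSymm ε C c *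
      ∑ d ∈ range 5, elemSymm ε D d * W a b c d)
    fun a ha => sum_eq_zero fun b _ => by
      rw [sum_eq_zero fun c _ => by
        rw [sum_eq_zero fun d _ => by rw [hW a b c d (by lia), mul_zero], mul_zero], mul_zero]
  simp only [← mul_sum, hD, hC, hB, hA]

theorem sum_range_four_eq_sum_splitTerms (f : ℕ × ℕ × ℕ × ℕ → ℤ)
    (hf : ∀ a b c d, ¬ (a + b + c + d < 5 ∧ Even (b + d) ∧ Even (c + d)) → f (a, b, c, d) = 0) :
    ∑ a ∈ range 5, ∑ b ∈ range 5, ∑ c ∈ range 5, ∑ d ∈ range 5, f (a, b, c, d) =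
      (splitTerms.map fun t => f t.2).sum := by
  have hmem : ∀ s ∈ range 5 ×ˢ range 5 ×ˢ range 5 ×ˢ range 5,
      (s.1 + s.2.1 + s.2.2.1 + s.2.2.2 < 5 ∧ Even (s.2.1 + s.2.2.2) ∧ Even (s.2.2.1 + s.2.2.2)) →
      s ∈ (splitTerms.map Prod.snd).toFinset := by
    decide +kernel
  have hsub : (splitTerms.map Prod.snd).toFinset ⊆ range 5 ×ˢ range 5 ×ˢ range 5 ×ˢ range 5 := by
    decide +kernel
  have hnodup : (splitTerms.map Prod.snd).Nodup := by
    decide +kernel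
  have hlist : (splitTerms.map fun t => f t.2) = (splitTerms.map Prod.snd).map f := by
    simp [Function.comp_def]
  rw [hlist, ← List.sum_toFinset f hnodup, sum_subset hsub]
  · simp only [sum_product]
  · rintro ⟨a, b, c, d⟩ h h'
    exact hf a b c d fun hc => h' (hmem (a, b, c, d) h hc)

theorem splitTerms_spec : ∀ t ∈ splitTerms,
    (t.2.1 + t.2.2.1 + t.2.2.2.1 + t.2.2.2.2 < 5 ∧ Even (t.2.2.1 + t.2.2.2.2) ∧
      Even (t.2.2.2.1 + t.2.2.2.2)) ∧
    (t.2.1 + t.2.2.1 + t.2.2.2.1 + t.2.2.2.2).factorial = t.1 * (t.2.1.factorial *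
      t.2.2.1.factorial * (t.2.2.2.1.factorial * t.2.2.2.2.factorial)) := by
  decide +kernel

theorem quadSum_eq_groupSum (w x y z : Fin 22 → Bool) :
    quadSum w x y z =
      groupSum #((diff w x)ᶜ ∩ (diff y z)ᶜ) #(diff w x \ diff y z) #(diff y z \ diff w x)
        #(diff w x ∩ diff y z)
        (∑ i ∈ (diff w x)ᶜ ∩ (diff y z)ᶜ, bitSign (w i) * bitSign (y i))
        (∑ i ∈ diff w x \ diff y z, bitSign (w i) * bitSign (y i))
        (∑ i ∈ diff y z \ diff w x, bitSign (w i) * bitSign (y i))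
        (∑ i ∈ diff w x ∩ diff y z, bitSign (w i) * bitSign (y i)) := by
  set ε : Fin 22 → ℤ := fun i => bitSign (w i) * bitSign (y i) with hε
  have hεε : ∀ i, ε i * ε i = 1 := fun i => by
    cases hw : w i <;> cases hy : y i <;> simp [hε, hw, hy, bitSign]
  have hterm (U) : subsetTerm U w x y z =
      if #U < 5 ∧ Even #(U ∩ diff w x) ∧ Even #(U ∩ diff y z) then
        (#U).factorial * (∏ i ∈ U, ε i) * kernel #U #(U ∩ diff w x) #(diff w x)
          #(U ∩ diff y z) #(diff y z) #((diff w x ∩ diff y z) \ U)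
      else 0 := by
    rw [subsetTerm, character, character, ← prod_mul_distrib]
  simp only [quadSum, hterm]
  generalize diff w x = d
  generalize diff y z = e
  let W (s₀ s₁ s₂ s₃ : ℕ) : ℤ :=
    if s₀ + s₁ + s₂ + s₃ < 5 ∧ Even (s₁ + s₃) ∧ Even (s₂ + s₃) then
      (s₀ + s₁ + s₂ + s₃).factorial *
        kernel (s₀ + s₁ + s₂ + s₃) (s₁ + s₃) #d (s₂ + s₃) #e (#(d ∩ e) - s₃)
    else 0
  have huniv : (univ : Finset (Finset (Fin 22))) =
      (dᶜ ∩ eᶜ ∪ (d \ e ∪ (e \ d ∪ d ∩ e))).powerset := by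
    rw [← powerset_univ]
    congr 1
    ext i
    by_cases h : i ∈ d <;> by_cases h' : i ∈ e <;> simp [h, h']
  have h23 : Disjoint (e \ d) (d ∩ e) :=
    disjoint_left.mpr fun i => by simp only [mem_sdiff, mem_inter]; tauto
  have h1 : Disjoint (d \ e) (e \ d ∪ d ∩ e) :=
    disjoint_left.mpr fun i => by simp only [mem_sdiff, mem_inter, mem_union]; tauto
  have h0 : Disjoint (dᶜ ∩ eᶜ) (d \ e ∪ (e \ d ∪ d ∩ e)) :=
    disjoint_left.mpr fun i => by
      simp only [mem_sdiff, mem_inter, mem_union, mem_compl]; tauto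
  rw [huniv, sum_powerset_union h0]
  simp only [sum_powerset_union h1, sum_powerset_union h23]
  have hsplit : ∀ S ∈ (dᶜ ∩ eᶜ).powerset, ∀ T ∈ (d \ e).powerset, ∀ U ∈ (e \ d).powerset,
      ∀ V ∈ (d ∩ e).powerset,
      (if #(S ∪ (T ∪ (U ∪ V))) < 5 ∧ Even #((S ∪ (T ∪ (U ∪ V))) ∩ d) ∧
          Even #((S ∪ (T ∪ (U ∪ V))) ∩ e) then
        (#(S ∪ (T ∪ (U ∪ V)))).factorial * (∏ i ∈ S ∪ (T ∪ (U ∪ V)), ε i) *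
          kernel #(S ∪ (T ∪ (U ∪ V))) #((S ∪ (T ∪ (U ∪ V))) ∩ d) #d
            #((S ∪ (T ∪ (U ∪ V))) ∩ e) #e #((d ∩ e) \ (S ∪ (T ∪ (U ∪ V))))
      else 0) =
      (∏ i ∈ S, ε i) * ((∏ i ∈ T, ε i) * ((∏ i ∈ U, ε i) * ((∏ i ∈ V, ε i) *
        W #S #T #U #V))) := by
    intro S hS T hT U hU V hV
    rw [mem_powerset] at hS hT hU hV
    have hUV : Disjoint U V := h23.mono hU hV
    have hTUV : Disjoint T (U ∪ V) := h1.mono hT (union_subset_union hU hV)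
    have hSTUV : Disjoint S (T ∪ (U ∪ V)) :=
      h0.mono hS (union_subset_union hT (union_subset_union hU hV))
    have hd : (S ∪ (T ∪ (U ∪ V))) ∩ d = T ∪ V := by
      ext i
      have := @hS i; have := @hT i; have := @hU i; have := @hV i
      simp only [mem_sdiff, mem_inter, mem_union, mem_compl] at *
      tauto
    have he : (S ∪ (T ∪ (U ∪ V))) ∩ e = U ∪ V := by
      ext i
      have := @hS i; have := @hT i; have := @hU i; have := @hV i
      simp only [mem_sdiff, mem_inter, mem_union, mem_compl] at *
      tauto
    have hde : (d ∩ e) \ (S ∪ (T ∪ (U ∪ V))) = (d ∩ e) \ V := by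
      ext i
      have := @hS i; have := @hT i; have := @hU i; have := @hV i
      simp only [mem_sdiff, mem_inter, mem_union, mem_compl] at *
      tauto
    have hcard : #(S ∪ (T ∪ (U ∪ V))) = #S + #T + #U + #V := by
      rw [card_union_of_disjoint hSTUV, card_union_of_disjoint hTUV, card_union_of_disjoint hUV]
      lia
    have hTV : Disjoint T V := disjoint_of_subset_right subset_union_right hTUV
    rw [hd, he, hde, hcard, card_union_of_disjoint hTV, card_union_of_disjoint hUV,
      card_sdiff_of_subset hV, Nat.cast_sub (card_le_card hV), prod_union hSTUV, prod_union hTUV,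
      prod_union hUV]
    simp only [W]
    split_ifs <;> ring
  rw [sum_congr rfl fun S hS => sum_congr rfl fun T hT => sum_congr rfl fun U hU =>
    sum_congr rfl fun V hV => hsplit S hS T hT U hU V hV]
  rw [sum_powerset_four ε _ _ _ _ W fun a b c d h => if_neg (by lia)]
  have hd : #d = #(d \ e) + #(d ∩ e) := (card_sdiff_add_card_inter d e).symm
  have he : #e = #(e \ d) + #(d ∩ e) := by
    rw [inter_comm, card_sdiff_add_card_inter]
  rw [sum_range_four_eq_sum_splitTerms (fun s => elemSymm ε (dᶜ ∩ eᶜ) s.1 *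
    (elemSymm ε (d \ e) s.2.1 * (elemSymm ε (e \ d) s.2.2.1 * (elemSymm ε (d ∩ e) s.2.2.2 *
      W s.1 s.2.1 s.2.2.1 s.2.2.2)))) fun a b c d h => by simp only [W, if_neg h, mul_zero]]
  rw [groupSum]
  congr 1
  refine List.map_congr_left fun t ht => ?_
  obtain ⟨hs, hm⟩ := splitTerms_spec t ht
  obtain ⟨m, s₀, s₁, s₂, s₃⟩ := t
  dsimp only at hs hm ⊢
  rw [← factorial_mul_elemSymm hεε _ (by lia), ← factorial_mul_elemSymm hεε _ (by lia),
    ← factorial_mul_elemSymm hεε _ (by lia), ← factorial_mul_elemSymm hεε _ (by lia)]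
  simp only [W, if_pos hs, hm, hd, he]
  push_cast
  ring

theorem diff_comm (w x : Fin 22 → Bool) : diff w x = diff x w := by
  simp only [diff, ne_comm]

theorem character_mul_character (U : Finset (Fin 22)) (w x : Fin 22 → Bool) :
    character U w * character U x = (-1) ^ #(U ∩ diff w x) := by
  rw [character, character, ← prod_mul_distrib, ← prod_const, ← prod_ite_mem]
  refine prod_congr rfl fun i _ => ?_
  cases hw : w i <;> cases hx : x i <;> simp [diff, bitSign, hw, hx]

theorem character_eq_of_even {U : Finset (Fin 22)} {w x : Fin 22 → Bool}
    (h : Even #(U ∩ diff w x)) : character U w = character U x := by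
  have hmul := character_mul_character U w x
  rw [h.neg_one_pow] at hmul
  rcases Int.eq_one_or_neg_one_of_mul_eq_one' hmul with h | h <;> rw [h.1, h.2]

theorem quadSum_swap_left (w x y z : Fin 22 → Bool) : quadSum w x y z = quadSum x w y z := by
  refine sum_congr rfl fun U _ => ?_
  rw [subsetTerm, subsetTerm, diff_comm x w]
  split_ifs with h
  · rw [character_eq_of_even h.2.1]
  · rfl

theorem quadSum_swap_pairs (w x y z : Fin 22 → Bool) : quadSum w x y z = quadSum y z w x := by
  refine sum_congr rfl fun U _ => ?_
  simp only [subsetTerm, inter_comm (diff w x), and_comm (a := Even #(U ∩ diff w x)),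
    mul_comm (character U w), kernel_comm _ #(U ∩ diff w x)]

theorem quadSum_swap_right (w x y z : Fin 22 → Bool) : quadSum w x y z = quadSum w x z y := by
  rw [quadSum_swap_pairs, quadSum_swap_left, quadSum_swap_pairs]

/-- The kernel summed over the three pairings of four words. -/
def symmSum (w x y z : Fin 22 → Bool) : ℤ := quadSum w x y z + quadSum w y x z + quadSum w z x y

theorem symmSum_swap₁ (w x y z : Fin 22 → Bool) : symmSum w x y z = symmSum x w y z := by
  simp only [symmSum]
  rw [quadSum_swap_left w x, quadSum_swap_pairs w y, quadSum_swap_pairs w z]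
  ring

theorem symmSum_swap₂ (w x y z : Fin 22 → Bool) : symmSum w x y z = symmSum w y x z := by
  simp only [symmSum]
  rw [quadSum_swap_right w z]
  ring

theorem symmSum_swap₃ (w x y z : Fin 22 → Bool) : symmSum w x y z = symmSum w x z y := by
  simp only [symmSum]
  rw [quadSum_swap_right w x]
  ring

/-- The number of coordinates where the differences of `w` with `x`, `y`, `z` are given bits. -/
def patternCount (w x y z : Fin 22 → Bool) (b c d : Bool) : ℕ :=
  #{i | (w i ^^ x i) = b ∧ (w i ^^ y i) = c ∧ (w i ^^ z i) = d}

theorem card_eq_sum_ite_mem (S : Finset (Fin 22)) : #S = ∑ i, if i ∈ S then 1 else 0 := by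
  simp

theorem sum_eq_sum_ite_mem (S : Finset (Fin 22)) (f : Fin 22 → ℤ) :
    ∑ i ∈ S, f i = ∑ i, if i ∈ S then f i else 0 := by
  simp

theorem card_diff_eq_patternCount (w x y z : Fin 22 → Bool) :
    #(diff w x) = patternCount w x y z true true true + patternCount w x y z true false false +
        (patternCount w x y z true false true + patternCount w x y z true true false) ∧
    #(diff y z) = patternCount w x y z false true false + patternCount w x y z false false true +
        (patternCount w x y z true false true + patternCount w x y z true true false) ∧
    #(diff w y) = patternCount w x y z true true true + patternCount w x y z false true false +
        (patternCount w x y z false true true + patternCount w x y z true true false) ∧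
    #(diff x z) = patternCount w x y z true false false + patternCount w x y z false false true +
        (patternCount w x y z false true true + patternCount w x y z true true false) ∧
    #(diff w z) = patternCount w x y z true true true + patternCount w x y z false false true +
        (patternCount w x y z false true true + patternCount w x y z true false true) ∧
    #(diff x y) = patternCount w x y z true false false + patternCount w x y z false true false +
        (patternCount w x y z false true true + patternCount w x y z true false true) := by
  refine ⟨?_, ?_, ?_, ?_, ?_, ?_⟩
  all_goals
    simp only [patternCount, diff, card_eq_sum_ite_mem, ← sum_add_distrib, mem_filter_univ]
    refine sum_congr rfl fun i _ => ?_
    generalize w i = a, x i = b, y i = c, z i = d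
    revert a b c d
    decide

theorem sum_patternCount (w x y z : Fin 22 → Bool) :
    patternCount w x y z false false false + patternCount w x y z true true true +
      patternCount w x y z true false false + patternCount w x y z false true false +
      patternCount w x y z false false true + patternCount w x y z false true true +
      patternCount w x y z true false true + patternCount w x y z true true false = 22 := by
  have h : 22 = ∑ i : Fin 22, 1 := by simp
  rw [h]
  simp only [patternCount, card_eq_sum_ite_mem, ← sum_add_distrib, mem_filter_univ]
  refine sum_congr rfl fun i _ => ?_
  generalize w i = a, x i = b, y i = c, z i = d
  revert a b c d
  decide

theorem quadSum_eq_groupSum_patternCount (w x y z : Fin 22 → Bool) :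
    quadSum w x y z = groupSum
      (patternCount w x y z false false false + patternCount w x y z false true true)
      (patternCount w x y z true true true + patternCount w x y z true false false)
      (patternCount w x y z false true false + patternCount w x y z false false true)
      (patternCount w x y z true false true + patternCount w x y z true true false)
      (patternCount w x y z false false false - patternCount w x y z false true true)
      (patternCount w x y z true false false - patternCount w x y z true true true)
      (patternCount w x y z false false true - patternCount w x y z false true false)
      (patternCount w x y z true false true - patternCount w x y z true true false) := by
  have hcard (b c d : Bool) : (patternCount w x y z b c d : ℤ) =
      ∑ i, if (w i ^^ x i) = b ∧ (w i ^^ y i) = c ∧ (w i ^^ z i) = d then 1 else 0 := by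
    rw [sum_boole, patternCount]
  rw [quadSum_eq_groupSum]
  congr 1
  iterate 4
    simp only [patternCount, diff, card_eq_sum_ite_mem, ← sum_add_distrib, mem_filter_univ,
      mem_inter, mem_compl, mem_sdiff]
    refine sum_congr rfl fun i _ => ?_
    generalize w i = a, x i = b, y i = c, z i = d
    revert a b c d
    decide
  all_goals
    rw [hcard, hcard, ← sum_sub_distrib, sum_eq_sum_ite_mem]
    refine sum_congr rfl fun i _ => ?_
    simp only [diff, mem_filter_univ, mem_inter, mem_compl, mem_sdiff]
    generalize w i = a, x i = b, y i = c, z i = d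
    revert a b c d
    decide

theorem patternCount_swap (w x y z : Fin 22 → Bool) (b c d : Bool) :
    patternCount w y x z b c d = patternCount w x y z c b d := by
  simp only [patternCount, and_left_comm]

theorem patternCount_rotate (w x y z : Fin 22 → Bool) (b c d : Bool) :
    patternCount w z x y b c d = patternCount w x y z c d b := by
  simp only [patternCount, and_rotate]

theorem symmSum_eq_countSum (w x y z : Fin 22 → Bool) :
    symmSum w x y z = countSum (patternCount w x y z false false false)
      (patternCount w x y z true true true) (patternCount w x y z true false false)
      (patternCount w x y z false true false) (patternCount w x y z false false true)
      (patternCount w x y z false true true) (patternCount w x y z true false true)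
      (patternCount w x y z true true false) := by
  simp only [symmSum, countSum, quadSum_eq_groupSum_patternCount, patternCount_swap w x y z,
    patternCount_rotate w x y z]

set_option maxHeartbeats 4000000 in
theorem checkCounts_eq_true {d : ℕ} (hd : d ≤ 22) : checkCounts d = true := by
  interval_cases d <;> decide +kernel

theorem countSum_nonpos_of_le {n a b c d p q r : ℕ} (hsum : n + a + b + c + d + p + q + r = 22)
    (hab : a ≤ b) (hbc : b ≤ c) (hcd : c ≤ d)
    (h₁ : isDist (a + b + (q + r))) (h₂ : isDist (c + d + (q + r)))
    (h₃ : isDist (a + c + (p + r))) (h₄ : isDist (b + d + (p + r)))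
    (h₅ : isDist (a + d + (p + q))) (h₆ : isDist (b + c + (p + q)))
    (hcount : [a + b + (q + r), c + d + (q + r), a + c + (p + r), b + d + (p + r),
      a + d + (p + q), b + c + (p + q)].count 0 ≤ 1) :
    countSum n a b c d p q r ≤ 0 := by
  have hn : n = 22 - (a + b + c + d + p + q + r) := by lia
  have hpar : ∀ {D}, isDist D → D % 2 = 0 := fun {D} h => by
    simp only [isDist, Bool.or_eq_true, Bool.and_eq_true, beq_iff_eq, decide_eq_true_eq] at h
    lia
  have e₁ := hpar h₁
  have e₂ := hpar h₂
  have e₃ := hpar h₃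
  have e₄ := hpar h₄
  have e₅ := hpar h₅
  have e₆ := hpar h₆
  have h := checkCounts_eq_true (d := d) (by lia)
  simp only [checkCounts, List.all_eq_true, List.mem_range] at h
  have h := h c (by lia) b (by lia) a (by lia)
  rw [Bool.or_eq_true, Bool.not_eq_true'] at h
  have h := h.resolve_left (by
    simp only [Bool.not_eq_false, Bool.and_eq_true, Nat.ble_eq, beq_iff_eq]
    lia)
  simp only [List.all_eq_true, List.mem_range] at h
  have h := h q (by lia) r (by lia)
  rw [Bool.or_eq_true, Bool.not_eq_true'] at h
  have h := h.resolve_left (by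
    rw [h₁, h₂]
    simp)
  simp only [List.all_eq_true, List.mem_range] at h
  have h := h p (by lia)
  rw [Bool.or_eq_true, Bool.not_eq_true'] at h
  have h := h.resolve_left (by
    rw [h₃, h₄, h₅, h₆, Nat.ble_eq_true_of_le hcount]
    simp)
  rw [hn]
  exact of_decide_eq_true h

theorem card_diff_eq_zero {w x : Fin 22 → Bool} : #(diff w x) = 0 ↔ w = x := by
  simp [diff, filter_eq_empty_iff, funext_iff]

/-- The number of coincidences among four words. -/
def coincidences (w x y z : Fin 22 → Bool) : ℕ :=
  [#(diff w x), #(diff y z), #(diff w y), #(diff x z), #(diff w z), #(diff x y)].count 0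

theorem coincidences_swap₁ (w x y z : Fin 22 → Bool) :
    coincidences w x y z = coincidences x w y z := by
  simp only [coincidences, diff_comm x w, List.count_cons, List.count_nil]
  lia

theorem coincidences_swap₂ (w x y z : Fin 22 → Bool) :
    coincidences w x y z = coincidences w y x z := by
  simp only [coincidences, diff_comm y x, List.count_cons, List.count_nil]
  lia

theorem coincidences_swap₃ (w x y z : Fin 22 → Bool) :
    coincidences w x y z = coincidences w x z y := by
  simp only [coincidences, diff_comm z y, List.count_cons, List.count_nil]
  lia

theorem patternCount_flip (w x y z : Fin 22 → Bool) (b c d : Bool) :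
    patternCount x w y z b c d = patternCount w x y z b (b ^^ c) (b ^^ d) := by
  rw [patternCount, patternCount]
  congr 1
  refine filter_congr fun i _ => ?_
  generalize w i = a, x i = b', y i = c', z i = d'
  revert a b c d b' c' d'
  decide

theorem patternCount_swap_last (w x y z : Fin 22 → Bool) (b c d : Bool) :
    patternCount w x z y b c d = patternCount w x y z b d c := by
  simp only [patternCount, and_comm (b := (w _ ^^ y _) = _)]

theorem symmSum_nonpos_of_coincidences_le {w x y z : Fin 22 → Bool}
    (h₁ : isDist #(diff w x)) (h₂ : isDist #(diff y z)) (h₃ : isDist #(diff w y))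
    (h₄ : isDist #(diff x z)) (h₅ : isDist #(diff w z)) (h₆ : isDist #(diff x y))
    (hco : coincidences w x y z ≤ 1) : symmSum w x y z ≤ 0 := by
  induction hm : 3 * patternCount w x y z true true true + 2 * patternCount w x y z true false false
    + patternCount w x y z false true false using Nat.strong_induction_on
    generalizing w x y z with
  | _ m ih =>
    by_cases hab : patternCount w x y z true true true ≤ patternCount w x y z true false false
    swap
    · rw [symmSum_swap₁]
      refine ih _ ?_ (diff_comm w x ▸ h₁) h₂ h₆ h₅ h₄ h₃ (coincidences_swap₁ w x y z ▸ hco) rfl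
      simp only [patternCount_flip w x y z, Bool.xor_self, Bool.xor_false, Bool.false_xor]
      lia
    by_cases hbc : patternCount w x y z true false false ≤ patternCount w x y z false true false
    swap
    · rw [symmSum_swap₂]
      refine ih _ ?_ h₃ h₄ h₁ h₂ h₅ (diff_comm x y ▸ h₆) (coincidences_swap₂ w x y z ▸ hco) rfl
      simp only [patternCount_swap w x y z]
      lia
    by_cases hcd : patternCount w x y z false true false ≤ patternCount w x y z false false true
    swap
    · rw [symmSum_swap₃]
      refine ih _ ?_ h₁ (diff_comm y z ▸ h₂) h₅ h₆ h₃ h₄ (coincidences_swap₃ w x y z ▸ hco) rfl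
      simp only [patternCount_swap_last w x y z]
      lia
    obtain ⟨e₁, e₂, e₃, e₄, e₅, e₆⟩ := card_diff_eq_patternCount w x y z
    rw [coincidences] at hco
    rw [e₁, e₂, e₃, e₄, e₅, e₆] at hco
    rw [symmSum_eq_countSum]
    exact countSum_nonpos_of_le (sum_patternCount w x y z) hab hbc hcd (e₁ ▸ h₁) (e₂ ▸ h₂)
      (e₃ ▸ h₃) (e₄ ▸ h₄) (e₅ ▸ h₅) (e₆ ▸ h₆) hco

theorem symmSum_one_three (w x : Fin 22 → Bool) :
    symmSum w x x x = countSum (22 - #(diff w x)) #(diff w x) 0 0 0 0 0 0 := by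
  have h := sum_patternCount w x x x
  obtain ⟨e₁, e₂, e₃, e₄, e₅, e₆⟩ := card_diff_eq_patternCount w x x x
  rw [card_diff_eq_zero.mpr rfl] at e₂ e₄
  rw [symmSum_eq_countSum]
  congr 1 <;> lia

theorem symmSum_two_two (w x : Fin 22 → Bool) :
    symmSum w w x x = countSum (22 - #(diff w x)) 0 0 0 0 #(diff w x) 0 0 := by
  have h := sum_patternCount w w x x
  obtain ⟨e₁, e₂, e₃, e₄, e₅, e₆⟩ := card_diff_eq_patternCount w w x x
  rw [card_diff_eq_zero.mpr rfl] at e₁ e₂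
  rw [symmSum_eq_countSum]
  congr 1 <;> lia

theorem symmSum_self (w : Fin 22 → Bool) : symmSum w w w w = countSum 22 0 0 0 0 0 0 0 := by
  rw [symmSum_one_three, card_diff_eq_zero.mpr rfl]

/-- The bound for the kernel at two pairs of coinciding words. The value at coinciding arguments
corrects for the overlaps of the cases. -/
def pairBound (w x : Fin 22 → Bool) : ℤ :=
  if w = x then -countSum 22 0 0 0 0 0 0 0 else symmSum w w x x

theorem symmSum_le {w x y z : Fin 22 → Bool}
    (h₁ : isDist #(diff w x)) (h₂ : isDist #(diff y z)) (h₃ : isDist #(diff w y))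
    (h₄ : isDist #(diff x z)) (h₅ : isDist #(diff w z)) (h₆ : isDist #(diff x y)) :
    symmSum w x y z ≤
      (if x = z then if x = y then symmSum w x x x else 0 else 0) +
      (if w = z then if w = y then symmSum x w w w else 0 else 0) +
      (if w = z then if w = x then symmSum y w w w else 0 else 0) +
      (if w = y then if w = x then symmSum z w w w else 0 else 0) +
      (if y = z then if w = x then pairBound w y else 0 else 0) +
      (if x = z then if w = y then pairBound w x else 0 else 0) +
      (if w = z then if x = y then pairBound w x else 0 else 0) := by
  by_cases hco : coincidences w x y z ≤ 1
  · refine (symmSum_nonpos_of_coincidences_le h₁ h₂ h₃ h₄ h₅ h₆ hco).trans (le_of_eq ?_)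
    simp only [coincidences, List.count_cons, List.count_nil, beq_iff_eq, card_diff_eq_zero] at hco
    split_ifs at hco ⊢ <;> simp_all
  simp only [coincidences, List.count_cons, List.count_nil, beq_iff_eq, card_diff_eq_zero] at hco
  have hwx : w = x → x = z → symmSum w x y z = symmSum y w w w := by
    rintro rfl rfl
    rw [symmSum_swap₂, symmSum_swap₁]
  by_cases e₁ : w = x
  · subst e₁
    by_cases e₂ : y = z
    · subst e₂
      by_cases e₃ : w = y
      · subst e₃
        simp only [if_true, pairBound, symmSum_self]
        lia
      · simp [e₃, pairBound]
    · by_cases e₃ : w = z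
      · subst e₃
        simp [hwx rfl rfl, Ne.symm e₂, e₂]
      · by_cases e₄ : w = y
        · subst e₄
          rw [symmSum_swap₃, symmSum_swap₂, symmSum_swap₁]
          simp [e₃]
        · simp [e₂, e₃, e₄] at hco
  · by_cases e₂ : y = z
    · subst e₂
      by_cases e₃ : w = y
      · subst e₃
        rw [symmSum_swap₁]
        simp [e₁, Ne.symm e₁]
      · by_cases e₄ : x = y
        · subst e₄
          simp [e₁]
        · simp [e₁, e₃, e₄] at hco
    · by_cases e₃ : w = y
      · subst e₃
        by_cases e₄ : x = z
        · subst e₄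
          rw [symmSum_swap₂]
          simp [e₁, Ne.symm e₁, pairBound]
        · simp [e₁, Ne.symm e₁, e₂, e₄] at hco
      · by_cases e₄ : w = z
        · subst e₄
          by_cases e₅ : x = y
          · subst e₅
            rw [symmSum_swap₃, symmSum_swap₂]
            simp [e₁, Ne.symm e₁, pairBound]
          · simp [e₁, Ne.symm e₁, e₂, e₃, e₅] at hco
        · grind

theorem sum_coincidence_patterns {ι : Type*} [Fintype ι] [DecidableEq ι] (G H : ι → ι → ℤ) :
    ∑ w, ∑ x, ∑ y, ∑ z,
      ((if x = z then if x = y then G w x else 0 else 0) +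
      (if w = z then if w = y then G x w else 0 else 0) +
      (if w = z then if w = x then G y w else 0 else 0) +
      (if w = y then if w = x then G z w else 0 else 0) +
      (if y = z then if w = x then H w y else 0 else 0) +
      (if x = z then if w = y then H w x else 0 else 0) +
      (if w = z then if x = y then H w x else 0 else 0)) =
    ∑ w, ∑ x, (4 * G w x + 3 * H w x) := by
  simp only [sum_add_distrib, sum_ite_eq, mem_univ, if_true, sum_ite_irrel, sum_const_zero,
    ← mul_sum]
  rw [sum_comm (f := fun w x => G x w)]
  ring

theorem sum_symmSum {ι : Type*} [Fintype ι] (f : ι → Fin 22 → Bool) :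
    ∑ w, ∑ x, ∑ y, ∑ z, symmSum (f w) (f x) (f y) (f z) =
      3 * ∑ w, ∑ x, ∑ y, ∑ z, quadSum (f w) (f x) (f y) (f z) := by
  simp only [symmSum, sum_add_distrib]
  have h₁ : ∑ w, ∑ x, ∑ y, ∑ z, quadSum (f w) (f y) (f x) (f z) =
      ∑ w, ∑ x, ∑ y, ∑ z, quadSum (f w) (f x) (f y) (f z) :=
    sum_congr rfl fun w _ => sum_comm
  have h₂ : ∑ w, ∑ x, ∑ y, ∑ z, quadSum (f w) (f z) (f x) (f y) =
      ∑ w, ∑ x, ∑ y, ∑ z, quadSum (f w) (f x) (f y) (f z) := by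
    refine sum_congr rfl fun w _ => ?_
    rw [sum_congr rfl fun x _ => sum_comm, sum_comm]
  rw [h₁, h₂]
  ring

theorem two_point_bound : ∀ D ∈ Icc 10 22, D % 2 = 0 →
    6 * gram 0 0 8 (rowIndex 0 D) + 4 * countSum (22 - D) D 0 0 0 0 0 0 +
      3 * countSum (22 - D) 0 0 0 0 D 0 0 ≤ 0 := by
  decide +kernel

theorem one_point_bound :
    3 * gram 0 0 8 8 < -85 * (6 * gram 0 0 8 (rowIndex 0 0) + countSum 22 0 0 0 0 0 0 0) ∧
      6 * gram 0 0 8 (rowIndex 0 0) + countSum 22 0 0 0 0 0 0 0 < 0 := by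
  decide +kernel

theorem card_le_of_isDist {C : Finset (Fin 22 → Bool)}
    (hC : ∀ u ∈ C, ∀ v ∈ C, isDist #(diff u v)) : #C ≤ 84 := by
  have hpsd := sum_quadSum_nonneg (C ×ˢ C)
  simp only [sum_product] at hpsd
  simp only [← sum_coe_sort C] at hpsd
  have hquad := sum_symmSum fun w : C => (w : Fin 22 → Bool)
  have hle := sum_le_sum fun (w : C) (_ : w ∈ univ) => sum_le_sum fun (x : C) (_ : x ∈ univ) =>
    sum_le_sum fun (y : C) (_ : y ∈ univ) => sum_le_sum fun (z : C) (_ : z ∈ univ) =>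
      symmSum_le (hC w w.2 x x.2) (hC y y.2 z z.2) (hC w w.2 y y.2) (hC x x.2 z z.2)
        (hC w w.2 z z.2) (hC x x.2 y y.2)
  simp only [← Subtype.ext_iff] at hle
  rw [sum_coincidence_patterns (fun w x : C => symmSum w x x x) fun w x => pairBound w x,
    hquad] at hle
  have hpair : ∑ w : C, ∑ x : C, (6 * gram 0 0 8 (rowIndex 0 #(diff w x)) +
      (4 * symmSum w x x x + 3 * pairBound w x)) ≤ ∑ w : C, ∑ x : C, if w = x then
        6 * gram 0 0 8 (rowIndex 0 0) + countSum 22 0 0 0 0 0 0 0 else 0 := by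
    refine sum_le_sum fun w _ => sum_le_sum fun x _ => ?_
    by_cases h : w = x
    · subst h
      simp only [if_true, pairBound, symmSum_self, card_diff_eq_zero.mpr]
      lia
    · have hne : (w : Fin 22 → Bool) ≠ x := fun e => h (Subtype.ext e)
      have h0 := card_diff_eq_zero.not.mpr hne
      have hd := hC w w.2 x x.2
      have h22 := card_le_univ (diff (w : Fin 22 → Bool) x)
      simp only [Fintype.card_fin] at h22
      simp only [isDist, Bool.or_eq_true, Bool.and_eq_true, beq_iff_eq, decide_eq_true_eq] at hd
      have := two_point_bound #(diff w x) (by rw [mem_Icc]; lia) (by lia)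
      simp only [if_neg h, pairBound, if_neg hne, symmSum_one_three, symmSum_two_two]
      lia
  simp only [sum_ite_eq, mem_univ, if_true, sum_const, card_univ, Fintype.card_coe,
    nsmul_eq_mul] at hpair
  obtain ⟨h₁, h₂⟩ := one_point_bound
  by_contra! hcard
  have hcard' : (85 : ℤ) ≤ #C := by exact_mod_cast hcard
  simp only [sum_add_distrib, ← mul_sum] at *
  nlinarith

/-- The word with coordinate `0` replaced by a parity check on the other coordinates. -/
def evenWord (w : Fin 22 → Bool) : Fin 22 → Bool :=
  Function.update w 0 (decide (character (univ.erase 0) w = -1))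

theorem character_evenWord (w : Fin 22 → Bool) : character univ (evenWord w) = 1 := by
  have hrest : ∏ i ∈ univ.erase 0, bitSign (evenWord w i) = character (univ.erase 0) w :=
    prod_congr rfl fun i hi => by rw [evenWord, Function.update_of_ne (ne_of_mem_erase hi)]
  have hone := character_mul_character (univ.erase 0) w w
  rw [card_eq_zero.mp (card_diff_eq_zero.mpr rfl), inter_empty, card_empty, pow_zero] at hone
  rw [character, ← mul_prod_erase univ _ (mem_univ 0), hrest, evenWord, Function.update_self]
  rcases Int.eq_one_or_neg_one_of_mul_eq_one hone with h | h <;> simp [h, bitSign]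

theorem even_card_diff_evenWord (w x : Fin 22 → Bool) :
    Even #(diff (evenWord w) (evenWord x)) := by
  have h := character_mul_character univ (evenWord w) (evenWord x)
  rw [character_evenWord, character_evenWord, univ_inter] at h
  by_contra hodd
  rw [(Nat.not_even_iff_odd.mp hodd).neg_one_pow] at h
  lia

theorem card_diff_le_card_diff_evenWord (w x : Fin 22 → Bool) :
    #(diff w x) ≤ #(diff (evenWord w) (evenWord x)) + 1 := by
  refine (card_le_card fun i hi => ?_).trans (card_insert_le 0 _)
  by_cases h : i = 0
  · simp [h]
  · rw [mem_insert, or_iff_right h]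
    refine mem_filter.mpr ⟨mem_univ i, ?_⟩
    rw [evenWord, evenWord, Function.update_of_ne h, Function.update_of_ne h]
    exact (mem_filter.mp hi).2

/-- `A(22,10) ≤ 84`: every binary code of length 22 in which any two distinct
codewords have Hamming distance at least 10 has at most 84 codewords. -/
theorem A_22_10_le_84 (C : Finset (Fin 22 → Bool))
    (hC : ∀ u ∈ C, ∀ v ∈ C, u ≠ v → 10 ≤ hammingDist u v) :
    C.card ≤ 84 := by
  have hdist : ∀ u ∈ C, ∀ v ∈ C, u ≠ v → 10 ≤ #(diff (evenWord u) (evenWord v)) := by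
    intro u hu v hv huv
    have h₁ : 10 ≤ #(diff u v) := hC u hu v hv huv
    have h₂ := card_diff_le_card_diff_evenWord u v
    have h₃ := Nat.even_iff.mp (even_card_diff_evenWord u v)
    lia
  have hinj : Set.InjOn evenWord C := by
    intro u hu v hv huv
    by_contra hne
    have h := hdist u hu v hv hne
    rw [card_diff_eq_zero.mpr huv] at h
    lia
  rw [← card_image_of_injOn hinj]
  refine card_le_of_isDist fun u' hu' v' hv' => ?_
  obtain ⟨u, hu, rfl⟩ := mem_image.mp hu'
  obtain ⟨v, hv, rfl⟩ := mem_image.mp hv'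
  have h₂ := Nat.even_iff.mp (even_card_diff_evenWord u v)
  by_cases h : u = v
  · simp [isDist, card_diff_eq_zero.mpr (congrArg evenWord h)]
  · simp only [isDist, Bool.or_eq_true, Bool.and_eq_true, beq_iff_eq, decide_eq_true_eq]
    exact Or.inr ⟨hdist u hu v hv h, h₂⟩
end

section
/- A(26,12) ≤ 96. That is, every binary code of length 26 in which any two distinct codewords have Hamming distance at least 12 has at most 96 codewords. -/
namespace BinaryCode

open Finset

/-- Indicator of the coordinates where two words differ. -/
def diff (x y : Fin 26 → Bool) (p : Fin 26) : ℤ := if x p = y p then 0 else 1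

lemma sum_diff (x y : Fin 26 → Bool) : ∑ p, diff x y p = hammingDist x y := by
  simp [diff, hammingDist, Finset.sum_ite]

lemma two_mul_diff_mul_diff (c x y : Fin 26 → Bool) (p : Fin 26) :
    2 * (diff c x p * diff c y p) = diff c x p + diff c y p - diff x y p := by
  unfold diff
  cases c p <;> cases x p <;> cases y p <;> rfl

lemma two_mul_sum_diff_mul_diff (c x y : Fin 26 → Bool) :
    2 * ∑ p, diff c x p * diff c y p =
      hammingDist c x + hammingDist c y - hammingDist x y := by
  simp only [mul_sum, two_mul_diff_mul_diff, sum_sub_distrib, sum_add_distrib, sum_diff]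

/-- The perimeter of a triangle in the cube `{0,1}²⁶` is at most `52`. -/
lemma perimeter_le (c x y : Fin 26 → Bool) :
    hammingDist c x + hammingDist c y + hammingDist x y ≤ 52 := by
  have h : ∑ p, (diff c x p + diff c y p + diff x y p) ≤ ∑ _p : Fin 26, (2 : ℤ) := by
    refine sum_le_sum fun p _ => ?_
    unfold diff
    cases c p <;> cases x p <;> cases y p <;> decide
  simp only [sum_add_distrib, sum_diff, sum_const, card_univ, Fintype.card_fin] at h
  norm_num at h
  exact_mod_cast h

/-- The degree one zonal kernel, as a function of the side lengths of a triangle. -/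
def kappa (i j l : ℕ) : ℤ := 13 * (i + j - l) - i * j

/-- The indicator of `x + c`, centred and scaled. -/
def dev (c x : Fin 26 → Bool) (p : Fin 26) : ℤ := 26 * diff c x p - hammingDist c x

lemma sum_dev_mul_dev (c x y : Fin 26 → Bool) :
    ∑ p, dev c x p * dev c y p =
      26 * kappa (hammingDist c x) (hammingDist c y) (hammingDist x y) := by
  have h : ∀ p, dev c x p * dev c y p = 338 * (2 * (diff c x p * diff c y p))
      - 26 * hammingDist c y * diff c x p - 26 * hammingDist c x * diff c y p
      + hammingDist c x * hammingDist c y := fun p => by unfold dev; ring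
  simp only [h, sum_add_distrib, sum_sub_distrib, ← mul_sum, two_mul_sum_diff_mul_diff, sum_diff,
    sum_const, card_univ, Fintype.card_fin, nsmul_eq_mul]
  unfold kappa
  push_cast
  ring

lemma sum_kappa_eq_sum_sq (A : Finset (Fin 26 → Bool)) (c : Fin 26 → Bool) (g : ℕ → ℤ) :
    26 * ∑ x ∈ A, ∑ y ∈ A, g (hammingDist c x) * g (hammingDist c y) *
      kappa (hammingDist c x) (hammingDist c y) (hammingDist x y) =
      ∑ p, (∑ x ∈ A, g (hammingDist c x) * dev c x p) ^ 2 := by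
  have h : ∑ p, (∑ x ∈ A, g (hammingDist c x) * dev c x p) ^ 2 = ∑ x ∈ A, ∑ y ∈ A, ∑ p,
      g (hammingDist c x) * dev c x p * (g (hammingDist c y) * dev c y p) := by
    simp only [sq, sum_mul_sum]
    rw [sum_comm]
    exact sum_congr rfl fun x _ => sum_comm
  simp only [h, mul_sum]
  refine sum_congr rfl fun x _ => sum_congr rfl fun y _ => ?_
  rw [mul_left_comm, ← sum_dev_mul_dev, mul_sum]
  exact sum_congr rfl fun p _ => by ring

lemma sum_kappa_nonneg (A : Finset (Fin 26 → Bool)) (c : Fin 26 → Bool) (g : ℕ → ℤ) :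
    0 ≤ ∑ x ∈ A, ∑ y ∈ A, g (hammingDist c x) * g (hammingDist c y) *
      kappa (hammingDist c x) (hammingDist c y) (hammingDist x y) := by
  have h := sum_kappa_eq_sum_sq A c g
  have h' : 0 ≤ ∑ p, (∑ x ∈ A, g (hammingDist c x) * dev c x p) ^ 2 :=
    sum_nonneg fun p _ => sq_nonneg _
  linarith

/-- Delsarte's inequality of degree two, sharpened for codes of odd size. -/
lemma sum_krawtchouk_two (C : Finset (Fin 26 → Bool)) (hC : Odd C.card) :
    650 ≤ ∑ x ∈ C, ∑ y ∈ C, ((26 - 2 * (hammingDist x y : ℤ)) ^ 2 - 26) := by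
  set χ : (Fin 26 → Bool) → Fin 26 → ℤ := fun x p => if x p then 1 else -1 with hχ
  have hsq : ∀ x p, χ x p * χ x p = 1 := fun x p => by simp only [hχ]; split <;> rfl
  have hd : ∀ x y, 26 - 2 * (hammingDist x y : ℤ) = ∑ p, χ x p * χ y p := fun x y => by
    have h : ∀ p, χ x p * χ y p = 1 - 2 * diff x y p := fun p => by
      simp only [hχ, diff]
      cases x p <;> cases y p <;> rfl
    simp only [h, sum_sub_distrib, ← mul_sum, sum_diff]
    simp
  have hsum : ∑ x ∈ C, ∑ y ∈ C, (26 - 2 * (hammingDist x y : ℤ)) ^ 2 =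
      ∑ p, ∑ q, (∑ x ∈ C, χ x p * χ x q) ^ 2 := by
    simp only [hd, sq, sum_mul_sum]
    rw [sum_congr rfl fun x _ => sum_comm, sum_comm]
    refine sum_congr rfl fun p _ => ?_
    rw [sum_congr rfl fun x _ => sum_comm, sum_comm]
    refine sum_congr rfl fun q _ => sum_congr rfl fun x _ => sum_congr rfl fun y _ => by ring
  have hodd : ∀ p q, 1 ≤ (∑ x ∈ C, χ x p * χ x q) ^ 2 := fun p q => by
    have h : Odd (∑ x ∈ C, χ x p * χ x q) := by
      rw [Int.odd_iff, Finset.sum_int_mod]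
      have : ∀ x ∈ C, χ x p * χ x q % 2 = 1 := fun x _ => by
        simp only [hχ]
        cases x p <;> cases x q <;> rfl
      rw [sum_congr rfl this]
      simp only [sum_const, nsmul_eq_mul, mul_one]
      exact_mod_cast Nat.odd_iff.1 hC
    have h0 : ∑ x ∈ C, χ x p * χ x q ≠ 0 := fun h0 => by simp [h0] at h
    have := sq_pos_of_ne_zero h0
    omega
  have hlow : ∑ p : Fin 26, ∑ q : Fin 26, (1 + if p = q then (C.card : ℤ) ^ 2 - 1 else 0) ≤
      ∑ p, ∑ q, (∑ x ∈ C, χ x p * χ x q) ^ 2 := by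
    refine sum_le_sum fun p _ => sum_le_sum fun q _ => ?_
    split_ifs with h
    · subst h
      simp [hsq]
    · simpa using hodd p q
  simp only [sum_sub_distrib, hsum]
  simp [sum_add_distrib] at hlow ⊢
  nlinarith

/-- The amount by which the distance of two distinct words exceeds `12`. -/
def excess (x y : Fin 26 → Bool) : ℤ := if x = y then 0 else hammingDist x y - 12

lemma hammingDist_eq_excess (x y : Fin 26 → Bool) :
    (hammingDist x y : ℤ) = excess x y + 12 - if x = y then 12 else 0 := by
  unfold excess
  split_ifs with h
  · simp [h]
  · ring

lemma excess_nonneg {S : Finset (Fin 26 → Bool)}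
    (hd : ∀ x ∈ S, ∀ y ∈ S, x ≠ y → 12 ≤ hammingDist x y) :
    ∀ x ∈ S, ∀ y ∈ S, 0 ≤ excess x y := fun x hx y hy => by
  unfold excess
  split_ifs with h
  · rfl
  · have := hd x hx y hy h
    omega

lemma sum_hammingDist (S : Finset (Fin 26 → Bool)) :
    ∑ x ∈ S, ∑ y ∈ S, (hammingDist x y : ℤ) =
      (∑ x ∈ S, ∑ y ∈ S, excess x y) + 12 * (S.card : ℤ) ^ 2 - 12 * S.card := by
  simp only [hammingDist_eq_excess, sum_sub_distrib, sum_add_distrib, sum_const, sum_ite_eq,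
    nsmul_eq_mul]
  rw [sum_congr rfl fun x hx => if_pos hx]
  simp only [sum_const, nsmul_eq_mul]
  ring

lemma hammingDist_eq_twelve {S : Finset (Fin 26 → Bool)}
    (hd : ∀ x ∈ S, ∀ y ∈ S, x ≠ y → 12 ≤ hammingDist x y)
    (h : ∑ x ∈ S, ∑ y ∈ S, excess x y ≤ 0) :
    ∀ x ∈ S, ∀ y ∈ S, x ≠ y → hammingDist x y = 12 := fun x hx y hy hxy => by
  have he := excess_nonneg hd
  have h1 := (sum_eq_zero_iff_of_nonneg fun x hx => sum_nonneg (he x hx)).1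
    (le_antisymm h (sum_nonneg fun x hx => sum_nonneg (he x hx))) x hx
  have h2 := (sum_eq_zero_iff_of_nonneg (he x hx)).1 h1 y hy
  simp only [excess, hxy, if_false] at h2
  omega

section Shell

variable {S : Finset (Fin 26 → Bool)} {c : Fin 26 → Bool}

lemma sum_sq_dev (hw : ∀ x ∈ S, hammingDist c x = 18) :
    ∑ p, (∑ x ∈ S, dev c x p) ^ 2 =
      26 * (156 * S.card - 12 * (S.card : ℤ) ^ 2 - 13 * ∑ x ∈ S, ∑ y ∈ S, excess x y) := by
  have h := sum_kappa_eq_sum_sq S c fun _ => 1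
  simp only [one_mul] at h
  rw [← h, sum_congr rfl fun x hx => sum_congr rfl fun y hy => by rw [hw x hx, hw y hy]]
  have hk : ∀ l : ℕ, kappa 18 18 l = 144 - 13 * l := fun l => by unfold kappa; push_cast; ring
  simp only [hk, sum_sub_distrib, sum_const, nsmul_eq_mul, ← mul_sum, sum_hammingDist]
  ring

/-- At most thirteen words of weight `18` are at mutual distance at least `12`. -/
lemma card_shell_le (hw : ∀ x ∈ S, hammingDist c x = 18)
    (hd : ∀ x ∈ S, ∀ y ∈ S, x ≠ y → 12 ≤ hammingDist x y) : S.card ≤ 13 := by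
  have h := sum_sq_dev hw
  have h1 : 0 ≤ ∑ p, (∑ x ∈ S, dev c x p) ^ 2 := sum_nonneg fun p _ => sq_nonneg _
  have h2 := sum_nonneg fun x hx => sum_nonneg (excess_nonneg hd x hx)
  by_contra h3
  have h4 : (14 : ℤ) ≤ S.card := by exact_mod_cast not_le.1 h3
  nlinarith

lemma hammingDist_of_card_eq_thirteen (hw : ∀ x ∈ S, hammingDist c x = 18)
    (hd : ∀ x ∈ S, ∀ y ∈ S, x ≠ y → 12 ≤ hammingDist x y) (hS : S.card = 13) :
    ∀ x ∈ S, ∀ y ∈ S, x ≠ y → hammingDist x y = 12 := by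
  have h := sum_sq_dev hw
  have h1 : 0 ≤ ∑ p, (∑ x ∈ S, dev c x p) ^ 2 := sum_nonneg fun p _ => sq_nonneg _
  refine hammingDist_eq_twelve hd ?_
  rw [hS] at h
  push_cast at h
  linarith

lemma sum_kappa_of_card_eq_thirteen (hw : ∀ x ∈ S, hammingDist c x = 18)
    (hd : ∀ x ∈ S, ∀ y ∈ S, x ≠ y → 12 ≤ hammingDist x y) (hS : S.card = 13)
    (x : Fin 26 → Bool) : ∑ y ∈ S, kappa (hammingDist c x) 18 (hammingDist x y) = 0 := by
  have h := sum_sq_dev hw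
  have h2 := sum_nonneg fun x hx => sum_nonneg (excess_nonneg hd x hx)
  have h1 : ∑ p, (∑ x ∈ S, dev c x p) ^ 2 = 0 := by
    refine le_antisymm ?_ (sum_nonneg fun p _ => sq_nonneg _)
    rw [hS] at h
    push_cast at h
    linarith
  have h3 := (sum_eq_zero_iff_of_nonneg fun p _ => sq_nonneg (∑ x ∈ S, dev c x p)).1 h1
  have h4 : 26 * ∑ y ∈ S, kappa (hammingDist c x) 18 (hammingDist x y) =
      ∑ p, dev c x p * ∑ y ∈ S, dev c y p := by
    simp only [mul_sum]
    rw [sum_comm]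
    refine sum_congr rfl fun y hy => ?_
    rw [sum_dev_mul_dev, hw y hy]
  have h5 : ∀ p, ∑ y ∈ S, dev c y p = 0 := fun p => by simpa using h3 p (mem_univ p)
  simpa [h5] using h4

lemma weight_of_card_eq_thirteen (hw : ∀ x ∈ S, hammingDist c x = 18)
    (hd : ∀ x ∈ S, ∀ y ∈ S, x ≠ y → 12 ≤ hammingDist x y) (hS : S.card = 13)
    {x : Fin 26 → Bool} (hx : ∀ y ∈ S, 12 ≤ hammingDist x y) : hammingDist c x < 16 := by
  by_contra h
  have h1 : ∑ y ∈ S, kappa (hammingDist c x) 18 (hammingDist x y) < ∑ y ∈ S, 0 := by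
    refine sum_lt_sum_of_nonempty (card_pos.1 (by omega)) fun y hy => ?_
    have := hx y hy
    unfold kappa
    push_cast
    omega
  rw [sum_kappa_of_card_eq_thirteen hw hd hS] at h1
  simp at h1

lemma two_mul_sum_compl (c x y : Fin 26 → Bool) :
    2 * ∑ p, (1 - diff c x p) * (1 - diff c y p) =
      52 - hammingDist c x - hammingDist c y - hammingDist x y := by
  have h : ∀ p, 2 * ((1 - diff c x p) * (1 - diff c y p)) =
      2 - diff c x p - diff c y p - diff x y p := fun p => by
    linear_combination two_mul_diff_mul_diff c x y p
  simp only [mul_sum, h, sum_sub_distrib, sum_diff]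
  simp

lemma sum_codegree (hw : ∀ x ∈ S, hammingDist c x = 18) :
    2 * ∑ p, ((∑ x ∈ S, (1 - diff c x p)) - 3) * ((∑ x ∈ S, (1 - diff c x p)) - 4) =
      4 * (S.card : ℤ) ^ 2 - 100 * S.card + 624 - ∑ x ∈ S, ∑ y ∈ S, excess x y := by
  have h1 : ∑ p, ∑ x ∈ S, (1 - diff c x p) = 8 * S.card := by
    rw [sum_comm, sum_congr rfl fun x hx => by
      rw [sum_sub_distrib, sum_diff, hw x hx]]
    simp
    ring
  have h2 : 2 * ∑ p, (∑ x ∈ S, (1 - diff c x p)) ^ 2 =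
      ∑ x ∈ S, ∑ y ∈ S, (16 - (hammingDist x y : ℤ)) := by
    simp only [sq, sum_mul_sum]
    rw [sum_comm, mul_sum]
    refine sum_congr rfl fun x hx => ?_
    rw [sum_comm, mul_sum]
    refine sum_congr rfl fun y hy => ?_
    rw [two_mul_sum_compl, hw x hx, hw y hy]
    push_cast
    ring
  have h3 : ∀ f : Fin 26 → ℤ,
      ∑ p, (f p - 3) * (f p - 4) = ∑ p, f p ^ 2 - 7 * ∑ p, f p + 312 := fun f => by
    have h : ∀ p, (f p - 3) * (f p - 4) = f p ^ 2 - 7 * f p + 12 := fun p => by ring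
    simp only [h, sum_add_distrib, sum_sub_distrib, mul_sum]
    simp
  simp only [sum_sub_distrib, sum_hammingDist] at h2
  simp only [sum_const, nsmul_eq_mul] at h2
  rw [h3, h1]
  simp only [sum_sub_distrib, sum_const, nsmul_eq_mul]
  linear_combination h2

lemma sub_three_mul_sub_four_nonneg (t : ℤ) : 0 ≤ (t - 3) * (t - 4) := by
  rcases le_or_gt t 3 with h | h <;> nlinarith

lemma hammingDist_of_card_eq_twelve (hw : ∀ x ∈ S, hammingDist c x = 18)
    (hd : ∀ x ∈ S, ∀ y ∈ S, x ≠ y → 12 ≤ hammingDist x y) (hS : S.card = 12) :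
    ∀ x ∈ S, ∀ y ∈ S, x ≠ y → hammingDist x y = 12 := by
  have h := sum_codegree hw
  have h1 := sum_nonneg fun p (_ : p ∈ univ) =>
    sub_three_mul_sub_four_nonneg (∑ x ∈ S, (1 - diff c x p))
  refine hammingDist_eq_twelve hd ?_
  rw [hS] at h
  push_cast at h
  linarith

lemma weight_of_card_eq_twelve (hw : ∀ x ∈ S, hammingDist c x = 18)
    (hd : ∀ x ∈ S, ∀ y ∈ S, x ≠ y → 12 ≤ hammingDist x y) (hS : S.card = 12)
    {x : Fin 26 → Bool} (hx : ∀ y ∈ S, 12 ≤ hammingDist x y) : hammingDist c x ≤ 18 := by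
  have h := sum_codegree hw
  have h1 := sum_nonneg fun p (_ : p ∈ univ) =>
    sub_three_mul_sub_four_nonneg (∑ x ∈ S, (1 - diff c x p))
  have h2 := sum_nonneg fun x hx => sum_nonneg (excess_nonneg hd x hx)
  rw [hS] at h
  push_cast at h
  have h3 := (sum_eq_zero_iff_of_nonneg fun p _ => sub_three_mul_sub_four_nonneg _).1
    (le_antisymm (by linarith) h1)
  have h4 : ∀ p, 3 ≤ ∑ x ∈ S, (1 - diff c x p) := fun p => by
    rcases mul_eq_zero.1 (h3 p (mem_univ p)) with h | h <;> linarith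
  have h5 : ∑ p, (1 - diff c x p) * 3 ≤ ∑ p, (1 - diff c x p) * ∑ y ∈ S, (1 - diff c y p) := by
    refine sum_le_sum fun p _ => mul_le_mul_of_nonneg_left (h4 p) ?_
    unfold diff
    split_ifs <;> norm_num
  have h6 : 2 * ∑ p, (1 - diff c x p) * ∑ y ∈ S, (1 - diff c y p) ≤
      ∑ y ∈ S, (22 - (hammingDist c x : ℤ)) := by
    simp only [mul_sum (s := S)]
    rw [sum_comm, mul_sum]
    refine sum_le_sum fun y hy => ?_
    rw [two_mul_sum_compl, hw y hy]
    have := hx y hy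
    omega
  rw [← sum_mul, sum_sub_distrib, sum_diff] at h5
  simp [hS] at h5 h6
  omega

end Shell

/-- The function of the weight `i` whose values at `12, 14, 16, …` are listed in `t`. -/
def tab (t : List ℤ) (i : ℕ) : ℤ := t.getD ((i - 12) / 2) 0

/-- The positive semidefinite matrix spanned by the listed vectors. -/
def gram (vs : List (List ℤ)) (i j : ℕ) : ℤ := (vs.map fun v => tab v i * tab v j).sum

/-- Coefficients of a linear combination of the inequalities satisfied by the distances within a
code, seen from a codeword `c` with a given number of codewords at distance `18`. -/
structure Certificate where
  /-- The number of codewords at distance `18` from `c`. -/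
  size : ℕ
  /-- The distances from `c` that may occur. -/
  weights : List ℕ
  /-- Whether the codewords at distance `18` from `c` are at mutual distance `12`. -/
  rigid : Bool
  /-- Vectors spanning the multiplier of the trivial kernel. -/
  sq₀ : List (List ℤ)
  /-- Vectors spanning the multiplier of `kappa`. -/
  sq₁ : List (List ℤ)
  /-- Multipliers of the equations counting all codewords. -/
  total : List ℤ
  /-- Multipliers of the equations counting codewords at distance `18` from `c`. -/
  shell : List ℤ
  /-- Multipliers of the equations `∑ kappa = 0` over the codewords at distance `18` from `c`. -/
  null : List ℤ

namespace Certificate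

/-- The part of `form` that is linear in the first weight. -/
def half (z : Certificate) (i j l : ℕ) : ℤ :=
  tab z.total i + if j = 18 then tab z.shell i + tab z.null i * kappa i 18 l else 0

/-- The contribution of a pair of codewords of weights `i`, `j` at distance `l`. -/
def form (z : Certificate) (i j l : ℕ) : ℤ :=
  gram z.sq₀ i j + gram z.sq₁ i j * kappa i j l + z.half i j l + z.half j i l

/-- The triangles that may occur. -/
def Allows (z : Certificate) (i j l : ℕ) : Prop :=
  i ∈ z.weights ∧ j ∈ z.weights ∧ (z.rigid = true → i = 18 → j = 18 → l = 12)

instance (z : Certificate) (i j l : ℕ) : Decidable (z.Allows i j l) := by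
  unfold Allows; infer_instance

end Certificate

lemma sum_gram_mul_nonneg (A : Finset (Fin 26 → Bool)) (c : Fin 26 → Bool) (vs : List (List ℤ))
    (k : (Fin 26 → Bool) → (Fin 26 → Bool) → ℤ)
    (hk : ∀ g : ℕ → ℤ, 0 ≤ ∑ x ∈ A, ∑ y ∈ A,
      g (hammingDist c x) * g (hammingDist c y) * k x y) :
    0 ≤ ∑ x ∈ A, ∑ y ∈ A, gram vs (hammingDist c x) (hammingDist c y) * k x y := by
  unfold gram
  induction vs with
  | nil => simp
  | cons v vs ih =>
    simp only [List.map_cons, List.sum_cons, add_mul, sum_add_distrib]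
    exact add_nonneg (hk (tab v)) ih

lemma le_sum_form (z : Certificate) (A : Finset (Fin 26 → Bool)) (c : Fin 26 → Bool)
    (hnull : ∀ x ∈ A, tab z.null (hammingDist c x) *
      ∑ y ∈ A with hammingDist c y = 18, kappa (hammingDist c x) 18 (hammingDist x y) = 0) :
    2 * ∑ x ∈ A, (A.card * tab z.total (hammingDist c x) +
      #{y ∈ A | hammingDist c y = 18} * tab z.shell (hammingDist c x)) ≤
      ∑ x ∈ A, ∑ y ∈ A, z.form (hammingDist c x) (hammingDist c y) (hammingDist x y) := by
  have h₀ := sum_gram_mul_nonneg A c z.sq₀ (fun _ _ => 1) fun g => by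
    simp only [mul_one, ← sum_mul_sum]
    exact mul_self_nonneg _
  have h₁ := sum_gram_mul_nonneg A c z.sq₁ _ (sum_kappa_nonneg A c)
  have h₂ : ∑ x ∈ A, ∑ y ∈ A, z.half (hammingDist c x) (hammingDist c y) (hammingDist x y) =
      ∑ x ∈ A, (A.card * tab z.total (hammingDist c x) +
        #{y ∈ A | hammingDist c y = 18} * tab z.shell (hammingDist c x)) := by
    refine sum_congr rfl fun x hx => ?_
    simp only [Certificate.half, sum_add_distrib, ← sum_filter, sum_const, nsmul_eq_mul,
      ← mul_sum, hnull x hx, add_zero]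
  have h₃ : ∑ x ∈ A, ∑ y ∈ A, z.half (hammingDist c y) (hammingDist c x) (hammingDist x y) =
      ∑ x ∈ A, ∑ y ∈ A, z.half (hammingDist c x) (hammingDist c y) (hammingDist x y) := by
    rw [sum_comm]
    exact sum_congr rfl fun x _ => sum_congr rfl fun y _ => by
      rw [hammingDist_comm y x]
  simp only [mul_one] at h₀
  simp only [Certificate.form, sum_add_distrib (s := A), h₃, h₂] at h₀ h₁ ⊢
  linarith

/-- The certificate for `13` codewords at distance `18`. -/
def cert₁₃ : Certificate where
  size := 13
  weights := [12, 14, 18]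
  rigid := true
  sq₀ := []
  sq₁ := [[532, 735], [196]]
  total := [-1928661, -738384, 0, 21039410]
  shell := [-8563411, -14172605, 0, -25004693]
  null := [109714, 95622]

/-- The certificate for `12` codewords at distance `18`. -/
def cert₁₂ : Certificate where
  size := 12
  weights := [12, 14, 16, 18]
  rigid := true
  sq₀ := [[-432, -2144, 2623], [0, 553]]
  sq₁ := [[49, -315, 523, 2245], [562, 774, 591], [55, 0, 58]]
  total := [-2020985, -609389, 5723974, 21102680]
  shell := [-8539718, -16794656, -11517079, 5170313]
  null := []

/-- The certificate for at most `11` codewords at distance `18`. -/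
def cert₁₁ : Certificate where
  size := 11
  weights := [12, 14, 16, 18, 20, 22, 24, 26]
  rigid := false
  sq₀ := [[-1325, -1918, -2259, 9739, 27706, 38638, 60050, 35906],
    [-753, -2672, 2153, 2556, 9476, 11136, 0, 37910],
    [-8, 7, -51, 90, 231, 1446],
    [-20, 18, -135, 236, 606]]
  sq₁ := [[-19, -333, 448, 3182, 5930, 5632, 1950],
    [-551, -667, -635, -292, 0, 404, 1128],
    [-52, -63, -60, -27, 0, 161],
    [120, 146, 139, 64]]
  total := [-3088870, -2814264, 4283474, 28458889, 65874145, 90811501, 123232852, 159854813]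
  shell := [0, 0, 0, -21854801]
  null := []

/-- The largest contribution of a triangle over all certificates that allow it. -/
def triangle (i j l : ℕ) : ℤ :=
  max (cert₁₁.form i j l)
    (max (if cert₁₂.Allows i j l then cert₁₂.form i j l else cert₁₁.form i j l)
      (if cert₁₃.Allows i j l then cert₁₃.form i j l else cert₁₁.form i j l))

/-- The contribution of an edge. -/
def edge (i : ℕ) : ℤ := -433935 * (97 * ((26 - 2 * (i : ℤ)) ^ 2 - 26) + 650)

lemma triangle_add_triangle_add_triangle_nonpos :
    ∀ i ∈ cert₁₁.weights, ∀ j ∈ cert₁₁.weights, ∀ l ∈ cert₁₁.weights,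
      l ≤ i + j → i ≤ j + l → j ≤ i + l → i + j + l ≤ 52 →
        triangle i j l + triangle i l j + triangle j l i ≤ 0 := by
  decide +kernel

/-- The certificate is valid at a codeword, provided the code has `97` codewords. -/
def Certificate.Valid (z : Certificate) : Prop :=
  (∀ i j l, z.Allows i j l → z.form i j l ≤ triangle i j l) ∧
    ∀ i ∈ z.weights, 0 < edge i + 192 * tab z.total i + 2 * z.size * tab z.shell i - z.form i i 0

lemma cert₁₁_valid : cert₁₁.Valid :=
  ⟨fun _ _ _ _ => le_max_left _ _, by decide +kernel⟩

lemma cert₁₂_valid : cert₁₂.Valid :=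
  ⟨fun _ _ _ h => le_max_of_le_right (le_max_of_le_left (by rw [if_pos h])), by decide +kernel⟩

lemma cert₁₃_valid : cert₁₃.Valid :=
  ⟨fun _ _ _ h => le_max_of_le_right (le_max_of_le_right (by rw [if_pos h])), by decide +kernel⟩

/-- The contribution of the ordered triangle `c`, `x`, `y`. -/
def term (c x y : Fin 26 → Bool) : ℤ :=
  if c = x ∨ c = y ∨ x = y then 0
  else triangle (hammingDist c x) (hammingDist c y) (hammingDist x y)

lemma Certificate.Valid.pos {z : Certificate} (hz : z.Valid) {A : Finset (Fin 26 → Bool)}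
    {c : Fin 26 → Bool} (hc : c ∉ A) (hA : A.card = 96)
    (hw : ∀ x ∈ A, hammingDist c x ∈ z.weights)
    (hrigid : z.rigid = true → ∀ x ∈ A, hammingDist c x = 18 → ∀ y ∈ A, hammingDist c y = 18 →
      x ≠ y → hammingDist x y = 12)
    (hshell : ∀ x ∈ A, z.size * tab z.shell (hammingDist c x) ≤
      #{y ∈ A | hammingDist c y = 18} * tab z.shell (hammingDist c x))
    (hnull : ∀ x ∈ A, tab z.null (hammingDist c x) *
      ∑ y ∈ A with hammingDist c y = 18, kappa (hammingDist c x) 18 (hammingDist x y) = 0) :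
    0 < ∑ x ∈ A, (∑ y ∈ A, term c x y + edge (hammingDist c x)) := by
  have h1 := le_sum_form z A c hnull
  have h2 : ∀ x ∈ A, ∑ y ∈ A, z.form (hammingDist c x) (hammingDist c y) (hammingDist x y) ≤
      ∑ y ∈ A, term c x y + z.form (hammingDist c x) (hammingDist c x) 0 := fun x hx => by
    have h : term c x x = 0 := by simp [term]
    rw [← sum_erase_add _ _ hx, ← sum_erase A h, hammingDist_self]
    refine add_le_add_left (sum_le_sum fun y hy => ?_) _
    obtain ⟨hyx, hy⟩ := mem_erase.1 hy
    have hcx : c ≠ x := fun h => hc (h ▸ hx)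
    have hcy : c ≠ y := fun h => hc (h ▸ hy)
    rw [term, if_neg (by simp [hcx, hcy, hyx.symm])]
    exact hz.1 _ _ _ ⟨hw x hx, hw y hy, fun h hx' hy' => hrigid h x hx hx' y hy hy' hyx.symm⟩
  have h3 : ∑ x ∈ A, (z.form (hammingDist c x) (hammingDist c x) 0 - edge (hammingDist c x)) <
      ∑ x ∈ A, (2 * (A.card * tab z.total (hammingDist c x) +
        #{y ∈ A | hammingDist c y = 18} * tab z.shell (hammingDist c x))) := by
    refine sum_lt_sum_of_nonempty (card_pos.1 (by omega)) fun x hx => ?_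
    have h4 := hz.2 _ (hw x hx)
    have h5 := hshell x hx
    rw [hA]
    push_cast
    linarith
  have h4 := sum_le_sum h2
  simp only [sum_add_distrib, sum_sub_distrib, ← mul_sum] at *
  linarith

section Code

variable {C : Finset (Fin 26 → Bool)}

/-- A code all of whose distances between distinct words are even and at least `12`. -/
def IsEvenCode (C : Finset (Fin 26 → Bool)) : Prop :=
  ∀ x ∈ C, ∀ y ∈ C, x ≠ y → 12 ≤ hammingDist x y ∧ Even (hammingDist x y)

lemma IsEvenCode.mem_weights (hC : IsEvenCode C) {x y : Fin 26 → Bool} (hx : x ∈ C) (hy : y ∈ C)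
    (hxy : x ≠ y) : hammingDist x y ∈ cert₁₁.weights := by
  obtain ⟨h1, k, hk⟩ := hC x hx y hy hxy
  have h2 : hammingDist x y ≤ 26 := by simpa using hammingDist_le_card_fintype (x := x) (y := y)
  simp only [cert₁₁, List.mem_cons, List.not_mem_nil]
  omega

lemma IsEvenCode.pos (hC : IsEvenCode C) (hcard : C.card = 97) {c : Fin 26 → Bool} (hc : c ∈ C) :
    0 < ∑ x ∈ C.erase c, (∑ y ∈ C.erase c, term c x y + edge (hammingDist c x)) := by
  have hA : (C.erase c).card = 96 := by rw [card_erase_of_mem hc, hcard]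
  have hcA : c ∉ C.erase c := notMem_erase c C
  have hd : ∀ x ∈ C.erase c, ∀ y ∈ C.erase c, x ≠ y → 12 ≤ hammingDist x y := fun x hx y hy h =>
    (hC x (mem_of_mem_erase hx) y (mem_of_mem_erase hy) h).1
  have hw : ∀ x ∈ C.erase c, hammingDist c x ∈ cert₁₁.weights := fun x hx =>
    hC.mem_weights hc (mem_of_mem_erase hx) (ne_of_mem_erase hx).symm
  generalize C.erase c = A at *
  set S := {y ∈ A | hammingDist c y = 18} with hS
  have hSA : S ⊆ A := filter_subset _ _
  have hSw : ∀ x ∈ S, hammingDist c x = 18 := fun x hx => (mem_filter.1 hx).2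
  have hSd : ∀ x ∈ S, ∀ y ∈ S, x ≠ y → 12 ≤ hammingDist x y := fun x hx y hy =>
    hd x (hSA hx) y (hSA hy)
  have hSx : ∀ x ∈ A, hammingDist c x ≠ 18 → ∀ y ∈ S, 12 ≤ hammingDist x y := fun x hx h y hy =>
    hd x hx y (hSA hy) fun hxy => h (hxy ▸ hSw y hy)
  rcases (card_shell_le hSw hSd).eq_or_lt with h13 | h13
  · refine cert₁₃_valid.pos hcA hA (fun x hx => ?_)
      (fun _ x hx hx' y hy hy' => hammingDist_of_card_eq_thirteen hSw hSd h13 x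
        (mem_filter.2 ⟨hx, hx'⟩) y (mem_filter.2 ⟨hy, hy'⟩))
      (fun x _ => by rw [← hS, h13]; rfl)
      (fun x _ => by rw [sum_kappa_of_card_eq_thirteen hSw hSd h13, mul_zero])
    have h1 := hw x hx
    have h2 := fun h => weight_of_card_eq_thirteen hSw hSd h13 (hSx x hx h)
    simp only [cert₁₁, cert₁₃, List.mem_cons, List.not_mem_nil, or_false] at h1 ⊢
    omega
  rcases (Nat.le_of_lt_succ h13).eq_or_lt with h12 | h12
  · refine cert₁₂_valid.pos hcA hA (fun x hx => ?_)
      (fun _ x hx hx' y hy hy' => hammingDist_of_card_eq_twelve hSw hSd h12 x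
        (mem_filter.2 ⟨hx, hx'⟩) y (mem_filter.2 ⟨hy, hy'⟩))
      (fun x _ => by rw [← hS, h12]; rfl)
      (fun x _ => by simp [cert₁₂, tab])
    have h1 := hw x hx
    have h2 := fun h => weight_of_card_eq_twelve hSw hSd h12 (hSx x hx h)
    simp only [cert₁₁, cert₁₂, List.mem_cons, List.not_mem_nil, or_false] at h1 ⊢
    omega
  · refine cert₁₁_valid.pos hcA hA hw (fun h => by simp [cert₁₁] at h) (fun x hx => ?_)
      (fun x _ => by simp [cert₁₁, tab])
    have h1 : ∀ i ∈ cert₁₁.weights, tab cert₁₁.shell i ≤ 0 := by decide +kernel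
    refine mul_le_mul_of_nonpos_right ?_ (h1 _ (hw x hx))
    exact_mod_cast Nat.le_of_lt_succ h12

lemma IsEvenCode.sum_term_nonpos (hC : IsEvenCode C) :
    ∑ c ∈ C, ∑ x ∈ C, ∑ y ∈ C, term c x y ≤ 0 := by
  have h1 : ∑ c ∈ C, ∑ x ∈ C, ∑ y ∈ C, term x c y = ∑ c ∈ C, ∑ x ∈ C, ∑ y ∈ C, term c x y :=
    sum_comm
  have h2 : ∑ c ∈ C, ∑ x ∈ C, ∑ y ∈ C, term y c x = ∑ c ∈ C, ∑ x ∈ C, ∑ y ∈ C, term c x y := by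
    rw [← h1, sum_congr rfl fun c _ => sum_comm, sum_comm]
  have h3 : ∑ c ∈ C, ∑ x ∈ C, ∑ y ∈ C, (term c x y + term x c y + term y c x) ≤ 0 := by
    refine sum_nonpos fun c hc => sum_nonpos fun x hx => sum_nonpos fun y hy => ?_
    by_cases hcx : c = x
    · simp [term, hcx]
    by_cases hcy : c = y
    · simp [term, hcy]
    by_cases hxy : x = y
    · simp [term, hxy]
    simp only [term, hcx, hcy, hxy, Ne.symm hcx, Ne.symm hcy, Ne.symm hxy, or_self, if_false]
    rw [hammingDist_comm x c, hammingDist_comm y c, hammingDist_comm y x]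
    refine triangle_add_triangle_add_triangle_nonpos _ (hC.mem_weights hc hx hcx)
      _ (hC.mem_weights hc hy hcy) _ (hC.mem_weights hx hy hxy) ?_ ?_ ?_ (perimeter_le c x y)
    · exact hammingDist_comm x c ▸ hammingDist_triangle x c y
    · exact hammingDist_comm y x ▸ hammingDist_triangle c y x
    · exact hammingDist_triangle c x y
  simp only [sum_add_distrib, h1, h2] at h3
  linarith

lemma sum_edge_nonpos (hcard : C.card = 97) :
    ∑ c ∈ C, ∑ x ∈ C.erase c, edge (hammingDist c x) ≤ 0 := by
  have h1 := sum_krawtchouk_two C (by rw [hcard]; decide)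
  have h2 : ∀ c ∈ C, ∑ x ∈ C.erase c, edge (hammingDist c x) =
      -433935 * (97 * (∑ x ∈ C, ((26 - 2 * (hammingDist c x : ℤ)) ^ 2 - 26) - 650) + 650 * 96) :=
    fun c hc => by
      rw [← sum_erase_add _ _ hc, hammingDist_self]
      simp only [edge, ← mul_sum, sum_add_distrib, sum_const, card_erase_of_mem hc, hcard]
      norm_num
  rw [sum_congr rfl h2]
  simp only [← mul_sum, sum_add_distrib, sum_sub_distrib, sum_const, hcard, nsmul_eq_mul] at h1 ⊢
  push_cast at h1 ⊢
  linarith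

lemma IsEvenCode.card_ne (hC : IsEvenCode C) : C.card ≠ 97 := fun hcard => by
  have h1 : 0 < ∑ c ∈ C, ∑ x ∈ C.erase c,
      (∑ y ∈ C.erase c, term c x y + edge (hammingDist c x)) :=
    sum_pos (fun c hc => hC.pos hcard hc) (card_pos.1 (by omega))
  have h2 : ∀ c, ∑ x ∈ C.erase c, ∑ y ∈ C.erase c, term c x y =
      ∑ x ∈ C, ∑ y ∈ C, term c x y := fun c => by
    rw [sum_congr rfl fun x _ => sum_erase C (f := term c x) (by simp [term])]
    exact sum_erase C (f := fun x => ∑ y ∈ C, term c x y) (by simp [term])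
  simp only [sum_add_distrib, h2] at h1
  linarith [hC.sum_term_nonpos, sum_edge_nonpos hcard]

end Code

/-- The word obtained from `x` by replacing its last letter with a parity check. -/
def parityFix (x : Fin 26 → Bool) : Fin 26 → Bool :=
  Function.update x 25 (decide (Odd #{p | p ≠ 25 ∧ x p = true}))

lemma even_card_parityFix (x : Fin 26 → Bool) : Even #{p | parityFix x p = true} := by
  have h : #{p | parityFix x p = true} = #{p | p ≠ 25 ∧ x p = true} +
      if Odd #{p | p ≠ 25 ∧ x p = true} then 1 else 0 := by
    rw [← card_filter_add_card_filter_not (s := {p | parityFix x p = true}) (· ≠ 25),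
      filter_filter, filter_filter]
    congr 1
    · congr 1
      ext p
      by_cases hp : p = 25 <;> simp [parityFix, hp]
    · split_ifs with h
      · rw [card_eq_one]
        refine ⟨25, ?_⟩
        ext p
        by_cases hp : p = 25 <;> simp_all [parityFix]
      · rw [card_eq_zero]
        ext p
        by_cases hp : p = 25 <;> simp_all [parityFix]
  rw [h]
  split_ifs with h
  · exact h.add_odd odd_one
  · simpa using h

lemma even_hammingDist {x y : Fin 26 → Bool} (hx : Even #{p | x p = true})
    (hy : Even #{p | y p = true}) : Even (hammingDist x y) := by
  have h := two_mul_sum_diff_mul_diff (fun _ => false) x y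
  have h0 : ∀ z : Fin 26 → Bool, hammingDist (fun _ => false) z = #{p | z p = true} := fun z => by
    unfold hammingDist
    congr 1
    ext p
    cases z p <;> simp
  rw [h0, h0] at h
  obtain ⟨a, ha⟩ := hx
  obtain ⟨b, hb⟩ := hy
  rw [ha, hb] at h
  rw [Nat.even_iff]
  push_cast at h
  omega

lemma hammingDist_le_parityFix (x y : Fin 26 → Bool) :
    hammingDist x y ≤ hammingDist (parityFix x) (parityFix y) + 1 := by
  unfold hammingDist
  have h : ({p | x p ≠ y p} : Finset (Fin 26)) ⊆
      insert 25 ({p | parityFix x p ≠ parityFix y p} : Finset (Fin 26)) := fun p hp => by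
    by_cases h25 : p = 25 <;> simp_all [parityFix]
  exact (card_le_card h).trans (card_insert_le _ _)

/-- A code of minimum distance `12` has at most `96` words. -/
lemma card_le {C : Finset (Fin 26 → Bool)}
    (hC : ∀ u ∈ C, ∀ v ∈ C, u ≠ v → 12 ≤ hammingDist u v) : C.card ≤ 96 := by
  by_contra h
  obtain ⟨B, hB, hcard⟩ := exists_subset_card_eq (n := 97) (by omega : 97 ≤ C.card)
  have hd : ∀ u ∈ B, ∀ v ∈ B, u ≠ v → 12 ≤ hammingDist (parityFix u) (parityFix v) ∧
      Even (hammingDist (parityFix u) (parityFix v)) := fun u hu v hv huv => by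
    have h1 := hC u (hB hu) v (hB hv) huv
    have h2 := hammingDist_le_parityFix u v
    obtain ⟨k, hk⟩ := even_hammingDist (even_card_parityFix u) (even_card_parityFix v)
    exact ⟨by omega, k, hk⟩
  have hinj : Set.InjOn parityFix B := fun u hu v hv huv => by
    by_contra hne
    have := (hd u hu v hv hne).1
    simp [huv] at this
  refine IsEvenCode.card_ne (C := B.image parityFix) ?_
    ((card_image_of_injOn hinj).trans hcard)
  simp only [IsEvenCode, forall_mem_image]
  exact fun u hu v hv huv => hd u hu v hv fun h => huv (h ▸ rfl)

end BinaryCode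

/-- `A(26,12) ≤ 96`: every binary code of length 26 in which any two distinct
codewords have Hamming distance at least 12 has at most 96 codewords. -/
theorem A_26_12_le_96 (C : Finset (Fin 26 → Bool))
    (hC : ∀ u ∈ C, ∀ v ∈ C, u ≠ v → 12 ≤ hammingDist u v) :
    C.card ≤ 96 :=
  BinaryCode.card_le hC
end
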